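/- Let k be a field and H a commutative noetherian Hopf algebra over k with bijective antipode. Assume that the category of left-right Yetter-Drinfeld modules over H satisfies condition (†), and that the coinvariants functor M ↦ M^{coH} from Yetter-Drinfeld modules to k-vector spaces is exact. Then every Yetter-Drinfeld module M that is finitely generated as an H-module is a direct sum, in the category of Yetter-Drinfeld modules, of a family of simple subobjects that are finitely generated as H-modules. -/

import Mathlib

/-!
Common definitions for formalizing "Semisimplicity of the categories of
Yetter-Drinfeld modules and Long dimodules" (Caenepeel, Guédénon).
-/

open TensorProduct

noncomputable section
namespace YDPaper

section RingPart

variable (k H : Type) [CommRing k] [Ring H] [HopfAlgebra k H]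

/-- `ρ : M →ₗ[k] M ⊗[k] H` is a (coassociative, counital) right `H`-comodule
structure on `M`. -/
def IsComod {M : Type} [AddCommGroup M] [Module k M] (ρ : M →ₗ[k] M ⊗[k] H) : Prop :=
  (∀ m : M, (TensorProduct.rid k M)
      ((LinearMap.lTensor M (Coalgebra.counit (R := k) (A := H))) (ρ m)) = m) ∧
  (∀ m : M, (TensorProduct.assoc k M H H) ((LinearMap.rTensor H ρ) (ρ m)) =
      (LinearMap.lTensor M (Coalgebra.comul (R := k) (A := H))) (ρ m))

/-- The iterated comultiplication `h ↦ (h₁ ⊗ h₂) ⊗ h₃`. -/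
def Delta2 : H →ₗ[k] (H ⊗[k] H) ⊗[k] H :=
  (LinearMap.rTensor H (Coalgebra.comul (R := k) (A := H))).comp
    (Coalgebra.comul (R := k) (A := H))

/-- The Yetter-Drinfeld compatibility condition
`ρ(h • m) = h₂ • m₀ ⊗ h₃ m₁ S⁻¹(h₁)`, expressed via arbitrary Sweedler
decompositions of `Δ²(h)` and `ρ(m)` into finite sums of pure tensors. -/
def IsYDCompat (Sinv : H →ₗ[k] H) {M : Type} [AddCommGroup M] [Module k M] [Module H M]
    (ρ : M →ₗ[k] M ⊗[k] H) : Prop :=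
  ∀ (h : H) (m : M) (s t : Finset ℕ) (a b c : ℕ → H) (m₀ : ℕ → M) (m₁ : ℕ → H),
    (∑ i ∈ s, (a i ⊗ₜ[k] b i) ⊗ₜ[k] c i) = Delta2 k H h →
    (∑ j ∈ t, m₀ j ⊗ₜ[k] m₁ j) = ρ m →
    ρ (h • m) = ∑ i ∈ s, ∑ j ∈ t, (b i • m₀ j) ⊗ₜ[k] (c i * m₁ j * Sinv (a i))

/-- The `k`-linear map `m ↦ h • m`. -/
def smulMap {M : Type} [AddCommGroup M] [Module k M] [Module H M] [SMulCommClass H k M]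
    (h : H) : M →ₗ[k] M where
  toFun m := h • m
  map_add' := smul_add h
  map_smul' c m := (smul_comm h c m)

/-- The Long dimodule compatibility condition `ρ(h • m) = h • m₀ ⊗ m₁`. -/
def IsLongCompat {M : Type} [AddCommGroup M] [Module k M] [Module H M] [SMulCommClass H k M]
    (ρ : M →ₗ[k] M ⊗[k] H) : Prop :=
  ∀ (h : H) (m : M), ρ (h • m) = (LinearMap.rTensor H (smulMap k H h)) (ρ m)

/-- Morphisms in the categories of Yetter-Drinfeld modules and of Long dimodules:
`H`-linear and `H`-colinear maps. -/
def IsHom {A B : Type} [AddCommGroup A] [Module k A] [Module H A]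
    [AddCommGroup B] [Module k B] [Module H B]
    (ρA : A →ₗ[k] A ⊗[k] H) (ρB : B →ₗ[k] B ⊗[k] H) (f : A →ₗ[k] B) : Prop :=
  (∀ (h : H) (a : A), f (h • a) = h • f a) ∧
  ρB.comp f = (LinearMap.rTensor H f).comp ρA

/-- `H`-colinearity of a `k`-linear map between right `H`-comodules. -/
def IsColin {A B : Type} [AddCommGroup A] [Module k A]
    [AddCommGroup B] [Module k B]
    (ρA : A →ₗ[k] A ⊗[k] H) (ρB : B →ₗ[k] B ⊗[k] H) (f : A →ₗ[k] B) : Prop :=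
  ρB.comp f = (LinearMap.rTensor H f).comp ρA

/-- A bundled left-right Yetter-Drinfeld module over `H` (with chosen inverse `Sinv`
of the antipode). -/
structure YDCat (Sinv : H →ₗ[k] H) where
  M : Type
  [iAdd : AddCommGroup M]
  [iModk : Module k M]
  [iModH : Module H M]
  [iTower : IsScalarTower k H M]
  [iComm : SMulCommClass H k M]
  ρ : M →ₗ[k] M ⊗[k] H
  comod : IsComod k H ρ
  compat : IsYDCompat k H Sinv ρ

attribute [instance] YDCat.iAdd YDCat.iModk YDCat.iModH YDCat.iTower YDCat.iComm

/-- A bundled left-right Long dimodule over `H`. -/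
structure LongCat where
  M : Type
  [iAdd : AddCommGroup M]
  [iModk : Module k M]
  [iModH : Module H M]
  [iTower : IsScalarTower k H M]
  [iComm : SMulCommClass H k M]
  ρ : M →ₗ[k] M ⊗[k] H
  comod : IsComod k H ρ
  compat : IsLongCompat k H ρ

attribute [instance] LongCat.iAdd LongCat.iModk LongCat.iModH LongCat.iTower LongCat.iComm

/-- A bundled right `H`-comodule. -/
structure ComodCat where
  V : Type
  [iAdd : AddCommGroup V]
  [iModk : Module k V]
  ρ : V →ₗ[k] V ⊗[k] H
  comod : IsComod k H ρ

attribute [instance] ComodCat.iAdd ComodCat.iModk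

section Subobjects

variable {k H}
variable {M : Type} [AddCommGroup M] [Module k M] [Module H M] [IsScalarTower k H M]

/-- A subobject in the category of Yetter-Drinfeld modules (or Long dimodules):
an `H`-submodule which is stable under the coaction, i.e. `ρ(p) ⊆ p ⊗ H`. -/
def IsSubobject (ρ : M →ₗ[k] M ⊗[k] H) (p : Submodule H M) : Prop :=
  ∀ m ∈ p, ρ m ∈ LinearMap.range (LinearMap.rTensor H (p.restrictScalars k).subtype)

/-- A simple subobject: a nonzero coaction-stable `H`-submodule with no proper
nonzero coaction-stable `H`-submodules. -/
def IsSimpleSubobject (ρ : M →ₗ[k] M ⊗[k] H) (p : Submodule H M) : Prop :=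
  IsSubobject ρ p ∧ p ≠ ⊥ ∧
    ∀ q : Submodule H M, IsSubobject ρ q → q ≤ p → q = ⊥ ∨ q = p

/-- `M` is the (internal) direct sum of a family of simple subobjects which are
finitely generated as `H`-modules. -/
def IsSemisimpleObj (ρ : M →ₗ[k] M ⊗[k] H) : Prop :=
  ∃ (ι : Type) (S : ι → Submodule H M),
    (∀ i, IsSimpleSubobject ρ (S i) ∧ (S i).FG) ∧
    iSupIndep S ∧ (⨆ i, S i) = ⊤

end Subobjects

section Subcomodules

variable {k H}
variable {V : Type} [AddCommGroup V] [Module k V]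

/-- A subcomodule: a `k`-submodule stable under the coaction. -/
def IsSubcomod (ρ : V →ₗ[k] V ⊗[k] H) (p : Submodule k V) : Prop :=
  ∀ v ∈ p, ρ v ∈ LinearMap.range (LinearMap.rTensor H p.subtype)

/-- A simple subcomodule. -/
def IsSimpleSubcomod (ρ : V →ₗ[k] V ⊗[k] H) (p : Submodule k V) : Prop :=
  IsSubcomod ρ p ∧ p ≠ ⊥ ∧
    ∀ q : Submodule k V, IsSubcomod ρ q → q ≤ p → q = ⊥ ∨ q = p

/-- A comodule is semisimple if it is the internal direct sum of a family of simple
subcomodules. -/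
def IsSemisimpleComod (ρ : V →ₗ[k] V ⊗[k] H) : Prop :=
  ∃ (ι : Type) (S : ι → Submodule k V),
    (∀ i, IsSimpleSubcomod ρ (S i)) ∧ iSupIndep S ∧ (⨆ i, S i) = ⊤

end Subcomodules

/-- `H` is cosemisimple: every right `H`-comodule is a direct sum of simple
subcomodules. -/
def Cosemisimple : Prop := ∀ C : ComodCat k H, IsSemisimpleComod C.ρ

section Coinv

variable {k H}
variable {A B : Type} [AddCommGroup A] [Module k A] [AddCommGroup B] [Module k B]

/-- The coinvariants `M^{co H} = { m | ρ m = m ⊗ 1 }` of a right `H`-comodule. -/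
def coinv (ρ : A →ₗ[k] A ⊗[k] H) : Submodule k A :=
  LinearMap.ker (ρ - (TensorProduct.mk k A H).flip 1)

lemma mem_coinv {ρ : A →ₗ[k] A ⊗[k] H} {a : A} :
    a ∈ coinv ρ ↔ ρ a = a ⊗ₜ[k] (1 : H) := by
  simp [coinv, LinearMap.mem_ker, sub_eq_zero]

/-- The map induced on coinvariants by an `H`-colinear map. -/
def coinvMap {ρA : A →ₗ[k] A ⊗[k] H} {ρB : B →ₗ[k] B ⊗[k] H} (f : A →ₗ[k] B)
    (hf : IsColin k H ρA ρB f) : ↥(coinv ρA) →ₗ[k] ↥(coinv ρB) :=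
  f.restrict (fun a ha => by
    have h1 : ρA a = a ⊗ₜ[k] (1 : H) := mem_coinv.1 ha
    have h2 : ρB (f a) = (LinearMap.rTensor H f) (ρA a) := by
      have := congrArg (fun (g : A →ₗ[k] B ⊗[k] H) => g a) hf
      simpa using this
    rw [mem_coinv, h2, h1, LinearMap.rTensor_tmul])

end Coinv

/-- Exactness of the coinvariants functor on the category of Yetter-Drinfeld
modules. -/
def CoinvExactYD (Sinv : H →ₗ[k] H) : Prop :=
  ∀ (A B C : YDCat k H Sinv) (f : A.M →ₗ[k] B.M) (g : B.M →ₗ[k] C.M)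
    (hf : IsHom k H A.ρ B.ρ f) (hg : IsHom k H B.ρ C.ρ g),
    Function.Injective f → Function.Surjective g →
    LinearMap.range f = LinearMap.ker g →
    Function.Injective (coinvMap f hf.2) ∧
    LinearMap.range (coinvMap f hf.2) = LinearMap.ker (coinvMap g hg.2) ∧
    Function.Surjective (coinvMap g hg.2)

/-- Exactness of the coinvariants functor on the category of right `H`-comodules. -/
def CoinvExactComod : Prop :=
  ∀ (A B C : ComodCat k H) (f : A.V →ₗ[k] B.V) (g : B.V →ₗ[k] C.V)
    (hf : IsColin k H A.ρ B.ρ f) (hg : IsColin k H B.ρ C.ρ g),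
    Function.Injective f → Function.Surjective g →
    LinearMap.range f = LinearMap.ker g →
    Function.Injective (coinvMap f hf) ∧
    LinearMap.range (coinvMap f hf) = LinearMap.ker (coinvMap g hg) ∧
    Function.Surjective (coinvMap g hg)

section Eval

variable {k H}
variable {M N : Type} [AddCommGroup M] [Module k M] [Module H M]
  [IsScalarTower k H M] [SMulCommClass H k M]
  [AddCommGroup N] [Module k N] [Module H N] [IsScalarTower k H N] [SMulCommClass H k N]

/-- Evaluation at `m` of `H`-linear maps, as a `k`-linear map. -/
def evalAtH (m : M) : (M →ₗ[H] N) →ₗ[k] N where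
  toFun f := f m
  map_add' _ _ := rfl
  map_smul' _ _ := rfl

/-- Evaluation at `m` of `k`-linear maps, as a `k`-linear map. -/
def evalAtK {V : Type} [AddCommGroup V] [Module k V] (v : V) :
    (V →ₗ[k] N) →ₗ[k] N where
  toFun f := f v
  map_add' _ _ := rfl
  map_smul' _ _ := rfl

/-- Contraction `N ⊗ H → N` along a functional `φ : H → k`. -/
def contract (φ : H →ₗ[k] k) : N ⊗[k] H →ₗ[k] N :=
  (TensorProduct.rid k N).toLinearMap.comp (LinearMap.lTensor N φ)

/-- Post-composition with an `H`-linear map, as a `k`-linear map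
`Hom_H(X, M) → Hom_H(X, N)`; here `X` is the (implicit) source. -/
def postcompH {X : Type} [AddCommGroup X] [Module k X] [Module H X]
    [IsScalarTower k H X] [SMulCommClass H k X]
    (f : M →ₗ[k] N) (hf : ∀ (h : H) (m : M), f (h • m) = h • f m) :
    (X →ₗ[H] M) →ₗ[k] (X →ₗ[H] N) where
  toFun φ :=
    { toFun := fun x => f (φ x)
      map_add' := fun x y => by simp
      map_smul' := fun h x => by simp [hf] }
  map_add' φ ψ := by ext x; simp
  map_smul' c φ := by ext x; simp

end Eval

/-- Condition (†) for the category of Yetter-Drinfeld modules: for every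
Yetter-Drinfeld module `X` which is finitely generated as a left `H`-module,
the functor `Hom_H(X, -)` is exact on the category of Yetter-Drinfeld modules. -/
def DaggerYD (Sinv : H →ₗ[k] H) : Prop :=
  ∀ X : YDCat k H Sinv, Module.Finite H X.M →
  ∀ (A B C : YDCat k H Sinv) (f : A.M →ₗ[k] B.M) (g : B.M →ₗ[k] C.M)
    (hf : IsHom k H A.ρ B.ρ f) (hg : IsHom k H B.ρ C.ρ g),
    Function.Injective f → Function.Surjective g →
    LinearMap.range f = LinearMap.ker g →
    Function.Injective (postcompH (X := X.M) f hf.1) ∧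
    LinearMap.range (postcompH (X := X.M) f hf.1) =
      LinearMap.ker (postcompH (X := X.M) g hg.1) ∧
    Function.Surjective (postcompH (X := X.M) g hg.1)

/-- Condition (†) for the category of Long dimodules. -/
def DaggerLong : Prop :=
  ∀ X : LongCat k H, Module.Finite H X.M →
  ∀ (A B C : LongCat k H) (f : A.M →ₗ[k] B.M) (g : B.M →ₗ[k] C.M)
    (hf : IsHom k H A.ρ B.ρ f) (hg : IsHom k H B.ρ C.ρ g),
    Function.Injective f → Function.Surjective g →
    LinearMap.range f = LinearMap.ker g →
    Function.Injective (postcompH (X := X.M) f hf.1) ∧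
    LinearMap.range (postcompH (X := X.M) f hf.1) =
      LinearMap.ker (postcompH (X := X.M) g hg.1) ∧
    Function.Surjective (postcompH (X := X.M) g hg.1)

/-- Projective object in the category of Yetter-Drinfeld modules. -/
def IsProjectiveYD (Sinv : H →ₗ[k] H) (P : YDCat k H Sinv) : Prop :=
  ∀ (A B : YDCat k H Sinv) (g : A.M →ₗ[k] B.M) (f : P.M →ₗ[k] B.M),
    IsHom k H A.ρ B.ρ g → Function.Surjective g → IsHom k H P.ρ B.ρ f →
    ∃ l : P.M →ₗ[k] A.M, IsHom k H P.ρ A.ρ l ∧ g.comp l = f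

/-- Projective object in the category of Long dimodules. -/
def IsProjectiveLong (P : LongCat k H) : Prop :=
  ∀ (A B : LongCat k H) (g : A.M →ₗ[k] B.M) (f : P.M →ₗ[k] B.M),
    IsHom k H A.ρ B.ρ g → Function.Surjective g → IsHom k H P.ρ B.ρ f →
    ∃ l : P.M →ₗ[k] A.M, IsHom k H P.ρ A.ρ l ∧ g.comp l = f

/-- Injective object in the category of Yetter-Drinfeld modules. -/
def IsInjectiveYD (Sinv : H →ₗ[k] H) (I : YDCat k H Sinv) : Prop :=
  ∀ (A B : YDCat k H Sinv) (ι : A.M →ₗ[k] B.M) (f : A.M →ₗ[k] I.M),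
    IsHom k H A.ρ B.ρ ι → Function.Injective ι → IsHom k H A.ρ I.ρ f →
    ∃ g : B.M →ₗ[k] I.M, IsHom k H B.ρ I.ρ g ∧ g.comp ι = f

/-- Projective object in the category of right `H`-comodules. -/
def IsProjectiveComod (P : ComodCat k H) : Prop :=
  ∀ (A B : ComodCat k H) (g : A.V →ₗ[k] B.V) (f : P.V →ₗ[k] B.V),
    IsColin k H A.ρ B.ρ g → Function.Surjective g → IsColin k H P.ρ B.ρ f →
    ∃ l : P.V →ₗ[k] A.V, IsColin k H P.ρ A.ρ l ∧ g.comp l = f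

section HomLemmas

variable {k H}
variable {A B C : Type} [AddCommGroup A] [Module k A] [Module H A]
  [AddCommGroup B] [Module k B] [Module H B]
  [AddCommGroup C] [Module k C] [Module H C]

lemma IsHom.comp' {ρA : A →ₗ[k] A ⊗[k] H} {ρB : B →ₗ[k] B ⊗[k] H} {ρC : C →ₗ[k] C ⊗[k] H}
    {f : A →ₗ[k] B} {g : B →ₗ[k] C}
    (hf : IsHom k H ρA ρB f) (hg : IsHom k H ρB ρC g) :
    IsHom k H ρA ρC (g.comp f) := by
  refine ⟨fun h a => by simp [LinearMap.comp_apply, hf.1, hg.1], ?_⟩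
  calc ρC.comp (g.comp f) = (ρC.comp g).comp f := by rw [LinearMap.comp_assoc]
    _ = ((LinearMap.rTensor H g).comp ρB).comp f := by rw [hg.2]
    _ = (LinearMap.rTensor H g).comp (ρB.comp f) := by rw [LinearMap.comp_assoc]
    _ = (LinearMap.rTensor H g).comp ((LinearMap.rTensor H f).comp ρA) := by rw [hf.2]
    _ = ((LinearMap.rTensor H g).comp (LinearMap.rTensor H f)).comp ρA := by
          rw [LinearMap.comp_assoc]
    _ = (LinearMap.rTensor H (g.comp f)).comp ρA := by rw [LinearMap.rTensor_comp]

end HomLemmas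

section HomYD

variable {k H}
variable (Sinv : H →ₗ[k] H)

/-- The `k`-module of morphisms of Yetter-Drinfeld modules `Hom_H^H(A, B)`, as a
submodule of the `k`-linear maps. -/
def homYD (A B : YDCat k H Sinv) : Submodule k (A.M →ₗ[k] B.M) where
  carrier := {f | IsHom k H A.ρ B.ρ f}
  add_mem' := by
    rintro f g ⟨hf1, hf2⟩ ⟨hg1, hg2⟩
    refine ⟨fun h a => by simp [hf1, hg1, smul_add], ?_⟩
    rw [LinearMap.comp_add, LinearMap.rTensor_add, LinearMap.add_comp, hf2, hg2]
  zero_mem' := by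
    refine ⟨fun h a => by simp, ?_⟩
    rw [LinearMap.comp_zero, LinearMap.rTensor_zero, LinearMap.zero_comp]
  smul_mem' := by
    rintro c f ⟨hf1, hf2⟩
    refine ⟨fun h a => by
      rw [LinearMap.smul_apply, LinearMap.smul_apply, hf1, smul_comm], ?_⟩
    rw [LinearMap.comp_smul, LinearMap.rTensor_smul, LinearMap.smul_comp, hf2]

/-- Post-composition with a morphism of Yetter-Drinfeld modules, as a `k`-linear map
between morphism spaces. -/
def postcompYD {X B C : YDCat k H Sinv}
    (g : B.M →ₗ[k] C.M) (hg : IsHom k H B.ρ C.ρ g) :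
    ↥(homYD Sinv X B) →ₗ[k] ↥(homYD Sinv X C) where
  toFun f := ⟨g.comp f.1, IsHom.comp' f.2 hg⟩
  map_add' f g' := by ext x; simp
  map_smul' c f := by ext x; simp

/-- An injective resolution `0 → X → I⁰ → I¹ → ⋯` in the category of
Yetter-Drinfeld modules. -/
structure IsInjRes (X : YDCat k H Sinv) (I : ℕ → YDCat k H Sinv)
    (ε : X.M →ₗ[k] (I 0).M) (d : ∀ n, (I n).M →ₗ[k] (I (n + 1)).M) : Prop where
  eps_hom : IsHom k H X.ρ (I 0).ρ ε
  d_hom : ∀ n, IsHom k H (I n).ρ (I (n + 1)).ρ (d n)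
  inj : ∀ n, IsInjectiveYD k H Sinv (I n)
  mono : Function.Injective ε
  exact0 : LinearMap.range ε = LinearMap.ker (d 0)
  exact : ∀ n, LinearMap.range (d n) = LinearMap.ker (d (n + 1))

/-- A projective resolution `⋯ → P₁ → P₀ → X → 0` in the category of
Yetter-Drinfeld modules. -/
structure IsProjRes (X : YDCat k H Sinv) (P : ℕ → YDCat k H Sinv)
    (ε : (P 0).M →ₗ[k] X.M) (d : ∀ n, (P (n + 1)).M →ₗ[k] (P n).M) : Prop where
  eps_hom : IsHom k H (P 0).ρ X.ρ ε
  d_hom : ∀ n, IsHom k H (P (n + 1)).ρ (P n).ρ (d n)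
  proj : ∀ n, IsProjectiveYD k H Sinv (P n)
  epi : Function.Surjective ε
  exact0 : LinearMap.range (d 0) = LinearMap.ker ε
  exact : ∀ n, LinearMap.range (d (n + 1)) = LinearMap.ker (d n)

/-- The projective dimension of `X` in the category of Yetter-Drinfeld modules is
at most `n`. -/
def pdimLE (X : YDCat k H Sinv) (n : ℕ) : Prop :=
  ∃ (P : ℕ → YDCat k H Sinv) (ε : (P 0).M →ₗ[k] X.M)
    (d : ∀ m, (P (m + 1)).M →ₗ[k] (P m).M),
    IsProjRes Sinv X P ε d ∧ ∀ i, n < i → Subsingleton (P i).M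

/-- The injective dimension of `X` in the category of Yetter-Drinfeld modules is
at most `n`. -/
def injdimLE (X : YDCat k H Sinv) (n : ℕ) : Prop :=
  ∃ (I : ℕ → YDCat k H Sinv) (ε : X.M →ₗ[k] (I 0).M)
    (d : ∀ m, (I m).M →ₗ[k] (I (m + 1)).M),
    IsInjRes Sinv X I ε d ∧ ∀ i, n < i → Subsingleton (I i).M

/-- The complex `Hom(X, I⁰) → Hom(X, I¹) → ⋯` of morphism spaces induced by a
cochain of Yetter-Drinfeld modules. -/
def homCx (X : YDCat k H Sinv) (I : ℕ → YDCat k H Sinv)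
    (d : ∀ n, (I n).M →ₗ[k] (I (n + 1)).M)
    (hd : ∀ n, IsHom k H (I n).ρ (I (n + 1)).ρ (d n)) (n : ℕ) :
    ↥(homYD Sinv X (I n)) →ₗ[k] ↥(homYD Sinv X (I (n + 1))) :=
  postcompYD Sinv (d n) (hd n)

/-- Coboundaries of the induced complex. -/
def boundaries (X : YDCat k H Sinv) (I : ℕ → YDCat k H Sinv)
    (d : ∀ n, (I n).M →ₗ[k] (I (n + 1)).M)
    (hd : ∀ n, IsHom k H (I n).ρ (I (n + 1)).ρ (d n)) :
    ∀ i, Submodule k ↥(homYD Sinv X (I i))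
  | 0 => ⊥
  | (i + 1) => LinearMap.range (homCx Sinv X I d hd i)

/-- The `i`-th cohomology (cocycles modulo coboundaries) of the complex
`Hom(X, I⁰) → Hom(X, I¹) → ⋯`; when `I` is an injective resolution of `Y`, this is
`Ext^i(X, Y)`, the `i`-th right derived functor of `Hom_H^H(X, -)`, in the category
of Yetter-Drinfeld modules. -/
abbrev cohomology (X : YDCat k H Sinv) (I : ℕ → YDCat k H Sinv)
    (d : ∀ n, (I n).M →ₗ[k] (I (n + 1)).M)
    (hd : ∀ n, IsHom k H (I n).ρ (I (n + 1)).ρ (d n)) (i : ℕ) : Type :=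
  ↥(Submodule.map (boundaries Sinv X I d hd i).mkQ
      (LinearMap.ker (homCx Sinv X I d hd i)))

end HomYD

section CharProps

variable {k H}
variable (Sinv : H →ₗ[k] H)

/-- Characterizing property of the coaction on `Hom_H(A, B)` for Yetter-Drinfeld
modules `A`, `B`: it is determined by `f₀(m) ⊗ f₁ = f(m₀)₀ ⊗ f(m₀)₁ S(m₁)`. -/
def HomCoactChar (A B : YDCat k H Sinv)
    (ρQ : (A.M →ₗ[H] B.M) →ₗ[k] (A.M →ₗ[H] B.M) ⊗[k] H) : Prop :=
  ∀ (f : A.M →ₗ[H] B.M) (m : A.M) (t : Finset ℕ) (m₀ : ℕ → A.M) (m₁ : ℕ → H),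
    (∑ j ∈ t, m₀ j ⊗ₜ[k] m₁ j) = A.ρ m →
    (LinearMap.rTensor H (evalAtH (N := B.M) m)) (ρQ f) =
      ∑ j ∈ t, (LinearMap.lTensor B.M
          (LinearMap.mulRight k (HopfAlgebra.antipode (R := k) (A := H) (m₁ j))))
        (B.ρ (f (m₀ j)))

/-- Characterizing property of the coaction on `Hom_k(V, B)` for a comodule `V` and
a Yetter-Drinfeld module `B`: `g₀(v) ⊗ g₁ = g(v₀)₀ ⊗ g(v₀)₁ S(v₁)`. -/
def HomKCoactChar (V : ComodCat k H) (B : YDCat k H Sinv)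
    (ρ' : (V.V →ₗ[k] B.M) →ₗ[k] (V.V →ₗ[k] B.M) ⊗[k] H) : Prop :=
  ∀ (g : V.V →ₗ[k] B.M) (v : V.V) (t : Finset ℕ) (v₀ : ℕ → V.V) (v₁ : ℕ → H),
    (∑ j ∈ t, v₀ j ⊗ₜ[k] v₁ j) = V.ρ v →
    (LinearMap.rTensor H (evalAtK (N := B.M) v)) (ρ' g) =
      ∑ j ∈ t, (LinearMap.lTensor B.M
          (LinearMap.mulRight k (HopfAlgebra.antipode (R := k) (A := H) (v₁ j))))
        (B.ρ (g (v₀ j)))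

/-- Characterizing property of the Yetter-Drinfeld coaction on `H ⊗ V`:
`ρ(h ⊗ v) = h₂ ⊗ v₀ ⊗ h₃ v₁ S⁻¹(h₁)`. -/
def HTensorYDChar (V : ComodCat k H)
    (ρT : (H ⊗[k] V.V) →ₗ[k] (H ⊗[k] V.V) ⊗[k] H) : Prop :=
  ∀ (h : H) (v : V.V) (s t : Finset ℕ) (a b c : ℕ → H) (v₀ : ℕ → V.V) (v₁ : ℕ → H),
    (∑ i ∈ s, (a i ⊗ₜ[k] b i) ⊗ₜ[k] c i) = Delta2 k H h →
    (∑ j ∈ t, v₀ j ⊗ₜ[k] v₁ j) = V.ρ v →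
    ρT (h ⊗ₜ[k] v) =
      ∑ i ∈ s, ∑ j ∈ t, (b i ⊗ₜ[k] v₀ j) ⊗ₜ[k] (c i * v₁ j * Sinv (a i))

/-- Characterizing property of the Long dimodule coaction on `H ⊗ V`:
`ρ(h ⊗ v) = h ⊗ v₀ ⊗ v₁`. -/
def HTensorLongChar (V : ComodCat k H)
    (ρT : (H ⊗[k] V.V) →ₗ[k] (H ⊗[k] V.V) ⊗[k] H) : Prop :=
  ∀ (h : H) (v : V.V) (t : Finset ℕ) (v₀ : ℕ → V.V) (v₁ : ℕ → H),
    (∑ j ∈ t, v₀ j ⊗ₜ[k] v₁ j) = V.ρ v →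
    ρT (h ⊗ₜ[k] v) = ∑ j ∈ t, (h ⊗ₜ[k] v₀ j) ⊗ₜ[k] v₁ j

end CharProps

end RingPart

section CommPart

variable {k H : Type} [CommRing k] [CommRing H] [HopfAlgebra k H] (Sinv : H →ₗ[k] H)

/-- Characterizing property of the Yetter-Drinfeld coaction on `M ⊗_H N`:
`ρ(m ⊗ n) = m₀ ⊗ n₀ ⊗ n₁ m₁` (for `H` commutative). -/
def TensorCoactChar (A B : YDCat k H Sinv)
    (ρT : (A.M ⊗[H] B.M) →ₗ[k] (A.M ⊗[H] B.M) ⊗[k] H) : Prop :=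
  ∀ (m : A.M) (n : B.M) (s t : Finset ℕ) (m₀ : ℕ → A.M) (m₁ : ℕ → H)
    (n₀ : ℕ → B.M) (n₁ : ℕ → H),
    (∑ i ∈ s, m₀ i ⊗ₜ[k] m₁ i) = A.ρ m →
    (∑ j ∈ t, n₀ j ⊗ₜ[k] n₁ j) = B.ρ n →
    ρT (m ⊗ₜ[H] n) =
      ∑ i ∈ s, ∑ j ∈ t, (m₀ i ⊗ₜ[H] n₀ j) ⊗ₜ[k] (n₁ j * m₁ i)

/-- Restriction along `v ↦ 1 ⊗ v`, i.e. the canonical map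
`Hom_H(H ⊗ V, N) → Hom_k(V, N)`, `f ↦ (v ↦ f(1 ⊗ v))`. -/
def resUnitMap (V : Type) [AddCommGroup V] [Module k V] (N : Type) [AddCommGroup N]
    [Module k N] [Module H N] [IsScalarTower k H N] [SMulCommClass H k N] :
    ((H ⊗[k] V) →ₗ[H] N) →ₗ[k] (V →ₗ[k] N) where
  toFun f := (f.restrictScalars k).comp ((TensorProduct.mk k H V) 1)
  map_add' f g := by ext v; rfl
  map_smul' c f := by ext v; rfl

end CommPart

set_option linter.unusedSectionVars false

section Aux
open WithConv

variable {k H : Type} [Field k] [CommRing H] [HopfAlgebra k H]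
variable {B : Type} [CommRing B] [Algebra k B]
variable {N X M : Type} [AddCommGroup N] [Module k N] [AddCommGroup X] [Module k X]
  [AddCommGroup M] [Module k M]

/-- `n ⊗ x ↦ n ⊗ b x`. -/
def rmul (b : B) : N ⊗[k] B →ₗ[k] N ⊗[k] B := LinearMap.lTensor N (LinearMap.mulLeft k b)

@[simp] lemma rmul_tmul (b x : B) (n : N) : rmul (k := k) b (n ⊗ₜ[k] x) = n ⊗ₜ (b * x) := rfl

lemma rmul_one_apply (w : N ⊗[k] B) : rmul (k := k) (1 : B) w = w := by
  induction w with
  | zero => simp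
  | add x y hx hy => rw [map_add, hx, hy]
  | tmul n x => simp

lemma rmul_rmul (b c : B) (w : N ⊗[k] B) :
    rmul (k := k) b (rmul (k := k) c w) = rmul (k := k) (b * c) w := by
  induction w with
  | zero => simp
  | add x y hx hy => simp only [map_add, hx, hy]
  | tmul n x => simp [mul_assoc]

lemma rTensor_rmul (f : N →ₗ[k] M) (b : B) (w : N ⊗[k] B) :
    LinearMap.rTensor B f (rmul (k := k) b w) = rmul (k := k) b (LinearMap.rTensor B f w) := by
  induction w with
  | zero => simp
  | add x y hx hy => simp only [map_add, hx, hy]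
  | tmul n x => simp

/-- `n ⊗ b ↦ n₀ ⊗ b φ(n₁)`. -/
def tw (ρ : N →ₗ[k] N ⊗[k] H) (φ : H →ₗ[k] B) : N ⊗[k] B →ₗ[k] N ⊗[k] B :=
  TensorProduct.lift
    (((LinearMap.lTensorHom N).comp (LinearMap.mul k B)).flip.comp
      ((LinearMap.lTensor N φ).comp ρ))

lemma tw_tmul (ρ : N →ₗ[k] N ⊗[k] H) (φ : H →ₗ[k] B) (n : N) (b : B) :
    tw ρ φ (n ⊗ₜ b) = rmul (k := k) b (LinearMap.lTensor N φ (ρ n)) := rfl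

lemma tw_tmul_one (ρ : N →ₗ[k] N ⊗[k] H) (φ : H →ₗ[k] B) (n : N) :
    tw ρ φ (n ⊗ₜ 1) = LinearMap.lTensor N φ (ρ n) := by
  rw [tw_tmul, rmul_one_apply]

lemma tw_id_tmul_one (ρ : N →ₗ[k] N ⊗[k] H) (n : N) :
    tw ρ LinearMap.id (n ⊗ₜ 1) = ρ n := by
  rw [tw_tmul_one]; simp

lemma tw_rmul (ρ : N →ₗ[k] N ⊗[k] H) (φ : H →ₗ[k] B) (b : B) (w : N ⊗[k] B) :
    tw ρ φ (rmul (k := k) b w) = rmul (k := k) b (tw ρ φ w) := by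
  induction w with
  | zero => simp
  | add x y hx hy => simp only [map_add, hx, hy]
  | tmul n x => rw [rmul_tmul, tw_tmul, tw_tmul, rmul_rmul]

/-- Two `rmul`-linear maps agreeing on `n ⊗ 1` are equal. -/
lemma ext_rmul {F G : N ⊗[k] B →ₗ[k] M ⊗[k] B}
    (hF : ∀ b w, F (rmul (k := k) b w) = rmul (k := k) b (F w))
    (hG : ∀ b w, G (rmul (k := k) b w) = rmul (k := k) b (G w))
    (h : ∀ n, F (n ⊗ₜ 1) = G (n ⊗ₜ 1)) : F = G := by
  ext n b
  have : n ⊗ₜ[k] b = rmul (k := k) b (n ⊗ₜ[k] (1 : B)) := by simp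
  simp only [AlgebraTensorModule.curry_apply, curry_apply, LinearMap.coe_restrictScalars]
  rw [this, hF, hG, h]

lemma rTensor_tw {ρN : N →ₗ[k] N ⊗[k] H} {ρM : M →ₗ[k] M ⊗[k] H} {f : N →ₗ[k] M}
    (hf : ρM.comp f = (LinearMap.rTensor H f).comp ρN) (φ : H →ₗ[k] B) (w : N ⊗[k] B) :
    LinearMap.rTensor B f (tw ρN φ w) = tw ρM φ (LinearMap.rTensor B f w) := by
  induction w with
  | zero => simp
  | add x y hx hy => simp only [map_add, hx, hy]
  | tmul n x =>
    rw [tw_tmul, LinearMap.rTensor_tmul, tw_tmul, rTensor_rmul]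
    have := LinearMap.congr_fun hf n
    simp only [LinearMap.comp_apply] at this
    rw [this, ← LinearMap.comp_apply (LinearMap.rTensor B f), ← LinearMap.comp_apply (LinearMap.lTensor M φ),
      LinearMap.rTensor_comp_lTensor, LinearMap.lTensor_comp_rTensor]

lemma tw_tw {ρ : N →ₗ[k] N ⊗[k] H}
    (hρ : ∀ m : N, (TensorProduct.assoc k N H H) ((LinearMap.rTensor H ρ) (ρ m)) =
      (LinearMap.lTensor N (Coalgebra.comul (R := k) (A := H))) (ρ m))
    (φ ψ : H →ₗ[k] B) (w : N ⊗[k] B) :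
    tw ρ φ (tw ρ ψ w) = tw ρ ((toConv φ * toConv ψ).ofConv) w := by
  have key : (tw ρ φ).comp (tw ρ ψ) = tw ρ ((toConv φ * toConv ψ).ofConv) := by
    apply ext_rmul
    · intro b w; simp only [LinearMap.comp_apply, tw_rmul]
    · intro b w; simp only [tw_rmul]
    · intro n
      rw [LinearMap.comp_apply, tw_tmul_one, tw_tmul_one]
      have h1 : ∀ z : N ⊗[k] H, tw ρ φ (LinearMap.lTensor N ψ z) =
          LinearMap.lTensor N (LinearMap.mul' k B ∘ₗ TensorProduct.map φ ψ)
            (TensorProduct.assoc k N H H (LinearMap.rTensor H ρ z)) := by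
        intro z
        induction z with
        | zero => simp
        | add x y hx hy => simp only [map_add, hx, hy]
        | tmul n x =>
          rw [LinearMap.lTensor_tmul, tw_tmul, LinearMap.rTensor_tmul]
          generalize ρ n = y
          induction y with
          | zero => simp
          | add x y hx hy => simp only [map_add, TensorProduct.add_tmul, hx, hy]
          | tmul n' y => simp [mul_comm]
      rw [h1, hρ, ← LinearMap.comp_apply, ← LinearMap.lTensor_comp]
      rfl
  exact LinearMap.congr_fun key w

lemma tw_one {ρ : N →ₗ[k] N ⊗[k] H}
    (hρ : ∀ m : N, (TensorProduct.rid k N)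
      ((LinearMap.lTensor N (Coalgebra.counit (R := k) (A := H))) (ρ m)) = m)
    (w : N ⊗[k] B) :
    tw ρ ((1 : WithConv (H →ₗ[k] B)).ofConv) w = w := by
  have key : tw ρ ((1 : WithConv (H →ₗ[k] B)).ofConv) = LinearMap.id := by
    apply ext_rmul
    · intro b w; simp only [tw_rmul]
    · intro b w; rfl
    · intro n
      rw [tw_tmul_one, LinearMap.convOne_def, LinearMap.lTensor_comp, LinearMap.comp_apply]
      have : (LinearMap.lTensor N (Coalgebra.counit (R := k) (A := H))) (ρ n) = n ⊗ₜ 1 := by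
        apply (TensorProduct.rid k N).injective
        rw [hρ]; simp
      rw [this]; simp
  exact LinearMap.congr_fun key w

/-- The base-change of a convolution-invertible pair. -/
lemma algHom_conv_antipode (φ : H →ₐ[k] B) :
    toConv φ.toLinearMap * toConv (φ.toLinearMap ∘ₗ HopfAlgebra.antipode k (A := H)) = 1 := by
  have h := LinearMap.algHom_comp_convMul_distrib φ
    (toConv (LinearMap.id (R := k) (M := H))) (toConv (HopfAlgebra.antipode k (A := H)))
  rw [LinearMap.id_mul_antipode] at h
  apply ofConv_injective
  rw [LinearMap.comp_id, ofConv_toConv] at h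
  rw [← h]
  ext x
  simp [LinearMap.convOne_def]

lemma tw_tw_antipode {ρ : N →ₗ[k] N ⊗[k] H} (hρ : IsComod k H ρ) (φ : H →ₐ[k] B)
    (w : N ⊗[k] B) :
    tw ρ φ.toLinearMap (tw ρ (φ.toLinearMap ∘ₗ HopfAlgebra.antipode k (A := H)) w) = w := by
  rw [tw_tw hρ.2, algHom_conv_antipode, tw_one hρ.1]

lemma tw_surjective {ρ : N →ₗ[k] N ⊗[k] H} (hρ : IsComod k H ρ) (φ : H →ₐ[k] B) :
    Function.Surjective (tw ρ φ.toLinearMap) := fun w => ⟨_, tw_tw_antipode hρ φ w⟩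

lemma tw_antipode_tw {ρ : N →ₗ[k] N ⊗[k] H} (hρ : IsComod k H ρ)
    (w : N ⊗[k] H) :
    tw ρ (HopfAlgebra.antipode k (A := H)) (tw ρ LinearMap.id w) = w := by
  rw [tw_tw hρ.2, LinearMap.antipode_mul_id, tw_one hρ.1]

/-- Criterion for being a comodule in terms of `tw`. -/
lemma isComod_of_tw {ρ : N →ₗ[k] N ⊗[k] H}
    (h1 : ∀ n, tw ρ (Coalgebra.counit (R := k) (A := H)) (n ⊗ₜ 1) = n ⊗ₜ 1)
    (h2 : ∀ n, tw ρ (Algebra.TensorProduct.includeLeft (R := k) (S := k) (A := H) (B := H)).toLinearMap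
        (tw ρ (Algebra.TensorProduct.includeRight (R := k) (A := H) (B := H)).toLinearMap
          (n ⊗ₜ 1)) = tw ρ (Coalgebra.comul (R := k) (A := H)) (n ⊗ₜ 1)) :
    IsComod k H ρ := by
  constructor
  · intro n
    have := h1 n
    rw [tw_tmul_one] at this
    rw [this]; simp
  · intro n
    have := h2 n
    rw [tw_tmul_one, tw_tmul_one] at this
    rw [← this]
    generalize ρ n = z
    induction z with
    | zero => simp
    | add x y hx hy => simp only [map_add, hx, hy]
    | tmul n x =>
      rw [LinearMap.lTensor_tmul, tw_tmul, LinearMap.rTensor_tmul]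
      generalize ρ n = y
      induction y with
      | zero => simp
      | add x y hx hy => simp only [map_add, TensorProduct.add_tmul, hx, hy]
      | tmul n' y => simp

lemma incl_conv : (toConv (Algebra.TensorProduct.includeLeft (R := k) (S := k) (A := H) (B := H)).toLinearMap
    * toConv (Algebra.TensorProduct.includeRight (R := k) (A := H) (B := H)).toLinearMap).ofConv
    = Coalgebra.comul (R := k) (A := H) := by
  have : LinearMap.mul' k (H ⊗[k] H) ∘ₗ TensorProduct.map
      (Algebra.TensorProduct.includeLeft (R := k) (S := k) (A := H) (B := H)).toLinearMap
      (Algebra.TensorProduct.includeRight (R := k) (A := H) (B := H)).toLinearMap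
      = LinearMap.id := by
    ext; simp
  rw [LinearMap.convMul_def, ofConv_toConv, ofConv_toConv, ← LinearMap.comp_assoc, this]
  rfl

end Aux

section Aux2
open WithConv

variable {k H : Type} [Field k] [CommRing H] [HopfAlgebra k H]
variable {B : Type} [CommRing B] [Algebra k B]
variable {N X M : Type}
  [AddCommGroup N] [Module k N] [Module H N] [IsScalarTower k H N] [SMulCommClass H k N]
  [AddCommGroup X] [Module k X] [Module H X] [IsScalarTower k H X] [SMulCommClass H k X]
  [AddCommGroup M] [Module k M] [Module H M] [IsScalarTower k H M] [SMulCommClass H k M]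

/-- The scalar action as a bilinear map. -/
def smulBil : H →ₗ[k] N →ₗ[k] N :=
  LinearMap.mk₂ k (fun h n => h • n) (fun a b n => add_smul a b n) (fun c a n => smul_assoc c a n)
    (fun a m n => smul_add a m n) (fun c a n => smul_comm a c n)

@[simp] lemma smulBil_apply (h : H) (n : N) : smulBil (k := k) h n = h • n := rfl

/-- Action of `H ⊗ H` on `N ⊗ H`. -/
def act : H ⊗[k] H →ₗ[k] N ⊗[k] H →ₗ[k] N ⊗[k] H :=
  TensorProduct.map₂ (smulBil (k := k)) (LinearMap.mul k H)

@[simp] lemma act_tmul (a b x : H) (n : N) :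
    act (k := k) (a ⊗ₜ b) (n ⊗ₜ x) = (a • n) ⊗ₜ (b * x) := rfl

lemma act_mul (y z : H ⊗[k] H) (w : N ⊗[k] H) :
    act (k := k) (y * z) w = act (k := k) y (act (k := k) z w) := by
  induction w with
  | zero => simp
  | add u v hu hv => simp only [map_add, hu, hv]
  | tmul n x =>
    induction y with
    | zero => simp
    | add u v hu hv => simp only [map_add, add_mul, LinearMap.add_apply, hu, hv]
    | tmul a b =>
      induction z with
      | zero => simp
      | add u v hu hv => simp only [map_add, mul_add, LinearMap.add_apply, hu, hv]
      | tmul c d => simp [mul_smul, mul_assoc]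

lemma act_one_tmul (b : H) (w : N ⊗[k] H) :
    act (k := k) ((1 : H) ⊗ₜ b) w = rmul (k := k) b w := by
  induction w with
  | zero => simp
  | add u v hu hv => simp only [map_add, hu, hv]
  | tmul n x => simp

lemma act_rmul (z : H ⊗[k] H) (b : H) (w : N ⊗[k] H) :
    act (k := k) z (rmul (k := k) b w) = rmul (k := k) b (act (k := k) z w) := by
  rw [← act_one_tmul, ← act_one_tmul, ← act_mul, ← act_mul, mul_comm]

lemma rTensor_act {f : N →ₗ[k] M} (hf : ∀ (h : H) n, f (h • n) = h • f n)
    (z : H ⊗[k] H) (w : N ⊗[k] H) :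
    LinearMap.rTensor H f (act (k := k) z w) = act (k := k) z (LinearMap.rTensor H f w) := by
  induction w with
  | zero => simp
  | add u v hu hv => simp only [map_add, hu, hv]
  | tmul n x =>
    induction z with
    | zero => simp
    | add u v hu hv => simp only [map_add, LinearMap.add_apply, hu, hv]
    | tmul a b => simp [hf]

/-- `γ(h) = h₂ ⊗ h₃ S⁻¹(h₁)` as a convolution product. -/
def gam (Sinv : H →ₗ[k] H) : WithConv (H →ₗ[k] H ⊗[k] H) :=
  toConv ((Algebra.TensorProduct.includeRight (R := k) (A := H) (B := H)).toLinearMap ∘ₗ Sinv)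
   * toConv (Algebra.TensorProduct.includeLeft (R := k) (S := k) (A := H) (B := H)).toLinearMap
   * toConv (Algebra.TensorProduct.includeRight (R := k) (A := H) (B := H)).toLinearMap

lemma gam_eq_sum (Sinv : H →ₗ[k] H) (h : H) (s : Finset ℕ) (a b c : ℕ → H)
    (hs : (∑ i ∈ s, (a i ⊗ₜ[k] b i) ⊗ₜ[k] c i) = Delta2 k H h) :
    (gam Sinv).ofConv h = ∑ i ∈ s, b i ⊗ₜ (c i * Sinv (a i)) := by
  set T : (H ⊗[k] H) ⊗[k] H →ₗ[k] H ⊗[k] H :=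
    LinearMap.mul' k (H ⊗[k] H) ∘ₗ TensorProduct.map
      (LinearMap.mul' k (H ⊗[k] H) ∘ₗ TensorProduct.map
        ((Algebra.TensorProduct.includeRight (R := k) (A := H) (B := H)).toLinearMap ∘ₗ Sinv)
        (Algebra.TensorProduct.includeLeft (R := k) (S := k) (A := H) (B := H)).toLinearMap)
      (Algebra.TensorProduct.includeRight (R := k) (A := H) (B := H)).toLinearMap with hT
  have h1 : (gam Sinv).ofConv h = T (Delta2 k H h) := by
    simp only [gam, LinearMap.convMul_def, ofConv_toConv, Delta2, hT, LinearMap.comp_apply]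
    rw [← LinearMap.comp_apply (TensorProduct.map _ _) (LinearMap.rTensor _ _),
      LinearMap.map_comp_rTensor]
    rfl
  rw [h1, ← hs, map_sum]
  refine Finset.sum_congr rfl fun i _ => ?_
  simp [hT, mul_comm]

lemma exists_sum_of_closure {T ι : Type*} [AddCommMonoid T] [Nonempty ι] (φ : ι → T)
    (h : AddSubmonoid.closure (Set.range φ) = ⊤) (x : T) :
    ∃ (n : ℕ) (u : ℕ → ι), ∑ i ∈ Finset.range n, φ (u i) = x := by
  have hx : x ∈ AddSubmonoid.closure (Set.range φ) := h ▸ AddSubmonoid.mem_top x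
  induction hx using AddSubmonoid.closure_induction with
  | mem x hx => obtain ⟨i, rfl⟩ := hx; exact ⟨1, fun _ => i, by simp⟩
  | zero => exact ⟨0, fun _ => Classical.arbitrary ι, by simp⟩
  | add x y _ _ hx hy =>
    obtain ⟨n, u, rfl⟩ := hx
    obtain ⟨m, v, rfl⟩ := hy
    refine ⟨n + m, fun i => if i < n then u i else v (i - n), ?_⟩
    rw [Finset.sum_range_add]
    congr 1
    · refine Finset.sum_congr rfl fun i hi => ?_
      simp [Finset.mem_range.1 hi]
    · refine Finset.sum_congr rfl fun i hi => ?_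
      simp

lemma exists_sum₂ (x : N ⊗[k] M) : ∃ (s : Finset ℕ) (a : ℕ → N) (b : ℕ → M),
    ∑ i ∈ s, a i ⊗ₜ[k] b i = x := by
  obtain ⟨n, u, hu⟩ := exists_sum_of_closure (fun p : N × M => p.1 ⊗ₜ[k] p.2) (by
    rw [eq_top_iff]
    intro x _
    induction x with
    | zero => exact zero_mem _
    | add x y hx hy => exact add_mem (hx trivial) (hy trivial)
    | tmul a b => exact AddSubmonoid.subset_closure ⟨(a, b), rfl⟩) x
  exact ⟨_, fun i => (u i).1, fun i => (u i).2, hu⟩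

lemma exists_sum₃ (x : (H ⊗[k] H) ⊗[k] H) : ∃ (s : Finset ℕ) (a b c : ℕ → H),
    ∑ i ∈ s, (a i ⊗ₜ[k] b i) ⊗ₜ[k] c i = x := by
  obtain ⟨n, u, hu⟩ := exists_sum_of_closure
    (fun p : H × H × H => (p.1 ⊗ₜ[k] p.2.1) ⊗ₜ[k] p.2.2) (by
    rw [eq_top_iff]
    intro x _
    induction x with
    | zero => exact zero_mem _
    | add x y hx hy => exact add_mem (hx trivial) (hy trivial)
    | tmul y c =>
      induction y with
      | zero => rw [TensorProduct.zero_tmul]; exact zero_mem _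
      | add x y hx hy => rw [TensorProduct.add_tmul]; exact add_mem (hx trivial) (hy trivial)
      | tmul a b => exact AddSubmonoid.subset_closure ⟨(a, b, c), rfl⟩) x
  exact ⟨_, fun i => (u i).1, fun i => (u i).2.1, fun i => (u i).2.2, hu⟩

lemma isYDCompat_iff (Sinv : H →ₗ[k] H) (ρ : N →ₗ[k] N ⊗[k] H) :
    IsYDCompat k H Sinv ρ ↔ ∀ h n, ρ (h • n) = act (k := k) ((gam Sinv).ofConv h) (ρ n) := by
  have aux : ∀ (s t : Finset ℕ) (a b c : ℕ → H) (m₀ : ℕ → N) (m₁ : ℕ → H),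
      act (k := k) (∑ i ∈ s, b i ⊗ₜ (c i * Sinv (a i))) (∑ j ∈ t, m₀ j ⊗ₜ[k] m₁ j) =
      ∑ i ∈ s, ∑ j ∈ t, (b i • m₀ j) ⊗ₜ[k] (c i * m₁ j * Sinv (a i)) := by
    intro s t a b c m₀ m₁
    simp only [map_sum, LinearMap.sum_apply, act_tmul]
    rw [Finset.sum_comm]
    refine Finset.sum_congr rfl fun i _ => Finset.sum_congr rfl fun j _ => ?_
    rw [mul_right_comm]
  constructor
  · intro hc h n
    obtain ⟨s, a, b, c, hs⟩ := exists_sum₃ (Delta2 k H h)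
    obtain ⟨t, m₀, m₁, ht⟩ := exists_sum₂ (ρ n)
    rw [hc h n s t a b c m₀ m₁ hs ht, gam_eq_sum Sinv h s a b c hs, ← ht, aux]
  · intro hc h n s t a b c m₀ m₁ hs ht
    rw [hc, gam_eq_sum Sinv h s a b c hs, ← ht, aux]

/-- `Sinv` is a convolution inverse of the identity. -/
lemma id_conv_Sinv (Sinv : H →ₗ[k] H)
    (hS1 : ∀ h : H, Sinv (HopfAlgebra.antipode (R := k) (A := H) h) = h)
    (hS2 : ∀ h : H, HopfAlgebra.antipode (R := k) (A := H) (Sinv h) = h) :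
    toConv (LinearMap.id (R := k) (M := H)) * toConv Sinv = 1 := by
  have h := LinearMap.algHom_comp_convMul_distrib (HopfAlgebra.antipodeAlgHom k H)
    (toConv (LinearMap.id (R := k) (M := H))) (toConv Sinv)
  have h2 : HopfAlgebra.antipode k (A := H) ∘ₗ Sinv = LinearMap.id := LinearMap.ext hS2
  rw [HopfAlgebra.toLinearMap_antipodeAlgHom] at h
  simp only [LinearMap.comp_id] at h
  rw [h2, LinearMap.antipode_mul_id] at h
  apply ofConv_injective
  ext x
  have h3 := LinearMap.congr_fun h x
  have h4 := congrArg Sinv h3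
  rw [LinearMap.comp_apply, hS1] at h4
  rw [h4]
  have h5 : Sinv 1 = 1 := by
    have := hS1 1
    rwa [HopfAlgebra.antipode_one] at this
  change Sinv (algebraMap k H (Coalgebra.counit x)) = algebraMap k H (Coalgebra.counit x)
  rw [Algebra.algebraMap_eq_smul_one, map_smul, h5]

/-- `j₂ * γ * (j₂ ∘ S) = j₁`. -/
lemma conv_gam (Sinv : H →ₗ[k] H)
    (hS1 : ∀ h : H, Sinv (HopfAlgebra.antipode (R := k) (A := H) h) = h)
    (hS2 : ∀ h : H, HopfAlgebra.antipode (R := k) (A := H) (Sinv h) = h) :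
    toConv (Algebra.TensorProduct.includeRight (R := k) (A := H) (B := H)).toLinearMap
    * gam Sinv
    * toConv ((Algebra.TensorProduct.includeRight (R := k) (A := H) (B := H)).toLinearMap ∘ₗ
        HopfAlgebra.antipode k (A := H)) =
    toConv (Algebra.TensorProduct.includeLeft (R := k) (S := k) (A := H) (B := H)).toLinearMap := by
  have h1 : toConv (Algebra.TensorProduct.includeRight (R := k) (A := H) (B := H)).toLinearMap *
      toConv ((Algebra.TensorProduct.includeRight (R := k) (A := H) (B := H)).toLinearMap ∘ₗ Sinv)
      = 1 := by
    have h := LinearMap.algHom_comp_convMul_distrib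
      (Algebra.TensorProduct.includeRight (R := k) (A := H) (B := H))
      (toConv (LinearMap.id (R := k) (M := H))) (toConv Sinv)
    rw [id_conv_Sinv Sinv hS1 hS2] at h
    apply ofConv_injective
    rw [LinearMap.comp_id, ofConv_toConv] at h
    rw [← h]
    ext x
    change (1 : H) ⊗ₜ[k] (algebraMap k H (Coalgebra.counit x)) =
      (algebraMap k H (Coalgebra.counit x)) ⊗ₜ[k] (1 : H)
    rw [Algebra.algebraMap_eq_smul_one, TensorProduct.tmul_smul, TensorProduct.smul_tmul']
  rw [gam, mul_assoc, mul_assoc _ _ (toConv (_ ∘ₗ HopfAlgebra.antipode k)),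
    algHom_conv_antipode, mul_one, ← mul_assoc, h1, one_mul]

/-- A map commuting with `γ(h)` and with `1 ⊗ b` commutes with `h ⊗ 1`. -/
lemma comm_incl (Sinv : H →ₗ[k] H)
    (hS1 : ∀ h : H, Sinv (HopfAlgebra.antipode (R := k) (A := H) h) = h)
    (hS2 : ∀ h : H, HopfAlgebra.antipode (R := k) (A := H) (Sinv h) = h)
    (F : X ⊗[k] H →ₗ[k] N ⊗[k] H)
    (h1 : ∀ b w, F (rmul (k := k) b w) = rmul (k := k) b (F w))
    (h2 : ∀ h w, F (act (k := k) ((gam Sinv).ofConv h) w) =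
      act (k := k) ((gam Sinv).ofConv h) (F w)) (h : H) (w : X ⊗[k] H) :
    F (act (k := k) (h ⊗ₜ 1) w) = act (k := k) (h ⊗ₜ 1) (F w) := by
  let P : WithConv (H →ₗ[k] H ⊗[k] H) → Prop := fun φ =>
    ∀ h w, F (act (k := k) (φ.ofConv h) w) = act (k := k) (φ.ofConv h) (F w)
  have hmul : ∀ φ ψ, P φ → P ψ → P (φ * ψ) := by
    intro φ ψ hφ hψ h w
    rw [LinearMap.convMul_def, ofConv_toConv, LinearMap.comp_apply, LinearMap.comp_apply]
    generalize Coalgebra.comul (R := k) h = z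
    induction z with
    | zero => simp
    | add u v hu hv => simp only [map_add, LinearMap.add_apply, hu, hv]
    | tmul a b =>
      rw [TensorProduct.map_tmul, LinearMap.mul'_apply, act_mul, act_mul, hφ, hψ]
  have hr : ∀ φ : H →ₗ[k] H, P (toConv
      ((Algebra.TensorProduct.includeRight (R := k) (A := H) (B := H)).toLinearMap ∘ₗ φ)) := by
    intro φ h w
    simp [act_one_tmul, h1]
  have := hmul _ _ (hmul _ _ (hr LinearMap.id) h2) (hr (HopfAlgebra.antipode k (A := H)))
  rw [LinearMap.comp_id, conv_gam Sinv hS1 hS2] at this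
  exact this h w

end Aux2

section Aux3
open WithConv

variable {k H : Type} [Field k] [CommRing H] [HopfAlgebra k H]
variable {B : Type} [CommRing B] [Algebra k B]
variable {N X M : Type}
  [AddCommGroup N] [Module k N] [Module H N] [IsScalarTower k H N] [SMulCommClass H k N]
  [AddCommGroup X] [Module k X] [Module H X] [IsScalarTower k H X] [SMulCommClass H k X]
  [AddCommGroup M] [Module k M] [Module H M] [IsScalarTower k H M] [SMulCommClass H k M]

/-- `H`-linear maps as `k`-linear maps, `k`-linearly. -/
def resK : (X →ₗ[H] N) →ₗ[k] X →ₗ[k] N where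
  toFun f := f.restrictScalars k
  map_add' _ _ := rfl
  map_smul' _ _ := rfl

@[simp] lemma resK_apply (f : X →ₗ[H] N) (x : X) : resK (k := k) f x = f x := rfl

/-- `ev (f ⊗ b) (x ⊗ c) = f x ⊗ b c`. -/
def ev : (X →ₗ[H] N) ⊗[k] B →ₗ[k] X ⊗[k] B →ₗ[k] N ⊗[k] B :=
  TensorProduct.map₂ (resK (k := k)) (LinearMap.mul k B)

@[simp] lemma ev_tmul (f : X →ₗ[H] N) (b c : B) (x : X) :
    ev (k := k) (f ⊗ₜ b) (x ⊗ₜ c) = f x ⊗ₜ (b * c) := rfl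

lemma ev_rmul (v : (X →ₗ[H] N) ⊗[k] B) (b : B) (w : X ⊗[k] B) :
    ev (k := k) v (rmul (k := k) b w) = rmul (k := k) b (ev (k := k) v w) := by
  induction w with
  | zero => simp
  | add u v hu hv => simp only [map_add, hu, hv]
  | tmul n x =>
    induction v with
    | zero => simp
    | add u v hu hv => simp only [map_add, LinearMap.add_apply, hu, hv]
    | tmul a c => simp [mul_left_comm]

lemma ev_rmul_left (v : (X →ₗ[H] N) ⊗[k] B) (b : B) (w : X ⊗[k] B) :
    ev (k := k) (rmul (k := k) b v) w = rmul (k := k) b (ev (k := k) v w) := by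
  induction w with
  | zero => simp
  | add u v hu hv => simp only [map_add, hu, hv]
  | tmul n x =>
    induction v with
    | zero => simp
    | add u v hu hv => simp only [map_add, LinearMap.add_apply, hu, hv]
    | tmul a c => simp [mul_assoc]

lemma ev_tmul_one_left (f : X →ₗ[H] N) (w : X ⊗[k] B) :
    ev (k := k) (f ⊗ₜ (1 : B)) w = LinearMap.rTensor B (resK (k := k) f) w := by
  induction w with
  | zero => simp
  | add u v hu hv => simp only [map_add, hu, hv]
  | tmul n x => simp

lemma ev_tmul_one_right (v : (X →ₗ[H] N) ⊗[k] B) (x : X) :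
    ev (k := k) v (x ⊗ₜ (1 : B)) = LinearMap.rTensor B ((resK (k := k)).flip x) v := by
  induction v with
  | zero => simp
  | add u v hu hv => simp only [map_add, LinearMap.add_apply, hu, hv]
  | tmul n x => simp

lemma coord_rTensor {ι : Type} [DecidableEq ι] (b : Module.Basis ι k B) {P Q : Type} [AddCommGroup P] [Module k P]
    [AddCommGroup Q] [Module k Q] (f : P →ₗ[k] Q) (w : P ⊗[k] B) (i : ι) :
    TensorProduct.equivFinsuppOfBasisRight b (LinearMap.rTensor B f w) i =
      f (TensorProduct.equivFinsuppOfBasisRight b w i) := by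
  induction w with
  | zero => simp
  | add u v hu hv => simp only [map_add, Finsupp.add_apply, hu, hv]
  | tmul n x => simp [TensorProduct.equivFinsuppOfBasisRight_apply_tmul_apply]

lemma ev_injective (v : (X →ₗ[H] N) ⊗[k] B) (h : ∀ x, ev (k := k) v (x ⊗ₜ (1 : B)) = 0) :
    v = 0 := by
  classical
  let b := Module.Basis.ofVectorSpace k B
  apply (TensorProduct.equivFinsuppOfBasisRight b).injective
  rw [map_zero]
  ext i x
  have := h x
  rw [ev_tmul_one_right] at this
  have h2 := coord_rTensor b ((resK (k := k)).flip x) v i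
  rw [this] at h2
  simpa using h2.symm

lemma ev_ext {u v : (X →ₗ[H] N) ⊗[k] B}
    (h : ∀ w, ev (k := k) u w = ev (k := k) v w) : u = v := by
  rw [← sub_eq_zero]
  apply ev_injective
  intro x
  rw [map_sub, LinearMap.sub_apply, h, sub_self]

lemma exists_ev [Module.Finite H X] (G : X →ₗ[k] N ⊗[k] H)
    (hG : ∀ (h : H) x, G (h • x) = act (k := k) (h ⊗ₜ 1) (G x)) :
    ∃ u : (X →ₗ[H] N) ⊗[k] H, ∀ x, ev (k := k) u (x ⊗ₜ (1 : H)) = G x := by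
  classical
  let b := Module.Basis.ofVectorSpace k H
  let e := TensorProduct.equivFinsuppOfBasisRight (M := N) b
  have hact : ∀ (h : H) (w : N ⊗[k] H), act (k := k) (h ⊗ₜ 1) w =
      LinearMap.rTensor H (smulBil (k := k) h) w := by
    intro h w
    induction w with
    | zero => simp
    | add u v hu hv => simp only [map_add, hu, hv]
    | tmul n x => simp
  let g : _ → (X →ₗ[H] N) := fun i =>
    { toFun := fun x => e (G x) i
      map_add' := fun x y => by simp
      map_smul' := fun h x => by
        rw [hG, hact]
        exact coord_rTensor b (smulBil (k := k) h) (G x) i }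
  obtain ⟨s, hs⟩ := (Module.finite_def (R := H) (M := X)).1 inferInstance
  let t := s.biUnion fun x => (e (G x)).support
  have hg : ∀ i, i ∉ t → g i = 0 := by
    intro i hi
    apply LinearMap.ext_on (s := (s : Set X)) hs
    intro x hx
    by_contra hne
    apply hi
    rw [Finset.mem_biUnion]
    exact ⟨x, hx, Finsupp.mem_support_iff.2 hne⟩
  refine ⟨∑ i ∈ t, g i ⊗ₜ b i, fun x => ?_⟩
  rw [map_sum, LinearMap.sum_apply]
  simp only [ev_tmul, mul_one]
  have h1 : G x = e.symm (e (G x)) := (e.symm_apply_apply _).symm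
  rw [h1, TensorProduct.equivFinsuppOfBasisRight_symm_apply, Finsupp.sum_of_support_subset (s := t)]
  · rfl
  · intro i hi
    by_contra hit
    have := LinearMap.congr_fun (hg i hit) x
    exact (Finsupp.mem_support_iff.1 hi) this
  · intro i _; simp

end Aux3

section HomObj
open WithConv
variable {k H : Type} [Field k] [CommRing H] [HopfAlgebra k H] {Sinv : H →ₗ[k] H}

lemma tw_smul (A : YDCat k H Sinv) (h : H) (w : A.M ⊗[k] H) :
    tw A.ρ LinearMap.id (LinearMap.rTensor H (smulBil (k := k) h) w) =
      act (k := k) ((gam Sinv).ofConv h) (tw A.ρ LinearMap.id w) := by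
  induction w with
  | zero => simp
  | add u v hu hv => simp only [map_add, hu, hv]
  | tmul n x =>
    rw [LinearMap.rTensor_tmul, tw_tmul, tw_tmul, act_rmul, smulBil_apply]
    simp only [LinearMap.lTensor_id, LinearMap.id_apply]
    rw [(isYDCompat_iff Sinv A.ρ).1 A.compat]

lemma exists_homρ (hS1 : ∀ h : H, Sinv (HopfAlgebra.antipode (R := k) (A := H) h) = h)
    (hS2 : ∀ h : H, HopfAlgebra.antipode (R := k) (A := H) (Sinv h) = h)
    (X N : YDCat k H Sinv) (hX : Module.Finite H X.M) (f : X.M →ₗ[H] N.M) :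
    ∃ u : (X.M →ₗ[H] N.M) ⊗[k] H, ∀ w,
      ev (k := k) u (tw X.ρ LinearMap.id w) =
        tw N.ρ LinearMap.id (LinearMap.rTensor H (resK (k := k) f) w) := by
  let F : X.M ⊗[k] H →ₗ[k] N.M ⊗[k] H :=
    tw N.ρ LinearMap.id ∘ₗ LinearMap.rTensor H (resK (k := k) f) ∘ₗ
      tw X.ρ (HopfAlgebra.antipode k (A := H))
  have hF : ∀ w, F (tw X.ρ LinearMap.id w) =
      tw N.ρ LinearMap.id (LinearMap.rTensor H (resK (k := k) f) w) := by
    intro w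
    simp only [F, LinearMap.comp_apply, tw_antipode_tw X.comod]
  have hr : ∀ b w, F (rmul (k := k) b w) = rmul (k := k) b (F w) := by
    intro b w
    simp only [F, LinearMap.comp_apply, tw_rmul, rTensor_rmul]
  have hsurj : Function.Surjective (tw X.ρ (LinearMap.id (R := k) (M := H))) :=
    tw_surjective X.comod (AlgHom.id k H)
  have hg : ∀ h w, F (act (k := k) ((gam Sinv).ofConv h) w) =
      act (k := k) ((gam Sinv).ofConv h) (F w) := by
    intro h w
    obtain ⟨w, rfl⟩ := hsurj w
    rw [← tw_smul, hF, hF, ← tw_smul]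
    congr 1
    rw [← LinearMap.comp_apply, ← LinearMap.comp_apply, ← LinearMap.rTensor_comp,
      ← LinearMap.rTensor_comp]
    congr 2
    ext x
    simp
  have hc := comm_incl Sinv hS1 hS2 F hr hg
  obtain ⟨u, hu⟩ := exists_ev (X := X.M) (N := N.M)
    (F ∘ₗ (TensorProduct.mk k X.M H).flip 1) (by
      intro h x
      have := hc h (x ⊗ₜ 1)
      simpa using this)
  refine ⟨u, fun w => ?_⟩
  rw [← hF]
  have : ev (k := k) u = F := ext_rmul (fun b w => ev_rmul u b w) hr (fun n => hu n)
  rw [this]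

/-- The coaction on `Hom_H(X, N)`. -/
def homρ (hS1 : ∀ h : H, Sinv (HopfAlgebra.antipode (R := k) (A := H) h) = h)
    (hS2 : ∀ h : H, HopfAlgebra.antipode (R := k) (A := H) (Sinv h) = h)
    (X N : YDCat k H Sinv) (hX : Module.Finite H X.M) :
    (X.M →ₗ[H] N.M) →ₗ[k] (X.M →ₗ[H] N.M) ⊗[k] H where
  toFun f := (exists_homρ hS1 hS2 X N hX f).choose
  map_add' f g := by
    apply ev_ext
    intro w
    obtain ⟨w, rfl⟩ := tw_surjective X.comod (AlgHom.id k H) w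
    have h1 := (exists_homρ hS1 hS2 X N hX f).choose_spec w
    have h2 := (exists_homρ hS1 hS2 X N hX g).choose_spec w
    have h3 := (exists_homρ hS1 hS2 X N hX (f + g)).choose_spec w
    have h4 : ∀ (u v : (X.M →ₗ[H] N.M) ⊗[k] H) w,
        ev (k := k) (u + v) w = ev (k := k) u w + ev (k := k) v w := by
      intro u v w; rw [map_add, LinearMap.add_apply]
    refine (h3.trans ?_).trans (h4 _ _ _).symm
    rw [map_add, LinearMap.rTensor_add, LinearMap.add_apply, map_add]
    exact congrArg₂ (· + ·) h1.symm h2.symm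
  map_smul' c f := by
    apply ev_ext
    intro w
    obtain ⟨w, rfl⟩ := tw_surjective X.comod (AlgHom.id k H) w
    have h1 := (exists_homρ hS1 hS2 X N hX f).choose_spec w
    have h3 := (exists_homρ hS1 hS2 X N hX (c • f)).choose_spec w
    have h4 : ∀ (u : (X.M →ₗ[H] N.M) ⊗[k] H) w,
        ev (k := k) (c • u) w = c • ev (k := k) u w := by
      intro u w; rw [map_smul, LinearMap.smul_apply]
    refine (h3.trans ?_).trans (h4 _ _).symm
    rw [map_smul, LinearMap.rTensor_smul, LinearMap.smul_apply, map_smul]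
    exact congrArg (c • ·) h1.symm

section
variable (hS1 : ∀ h : H, Sinv (HopfAlgebra.antipode (R := k) (A := H) h) = h)
    (hS2 : ∀ h : H, HopfAlgebra.antipode (R := k) (A := H) (Sinv h) = h)
    (X N : YDCat k H Sinv) (hX : Module.Finite H X.M)

lemma homρ_spec (f : X.M →ₗ[H] N.M) (w : X.M ⊗[k] H) :
      ev (k := k) (homρ hS1 hS2 X N hX f) (tw X.ρ LinearMap.id w) =
        tw N.ρ LinearMap.id (LinearMap.rTensor H (resK (k := k) f) w) :=
  (exists_homρ hS1 hS2 X N hX f).choose_spec w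

variable {B : Type} [CommRing B] [Algebra k B]

lemma ev_lTensor (φ : H →ₐ[k] B) (u : (X.M →ₗ[H] N.M) ⊗[k] H) (w : X.M ⊗[k] H) :
    ev (k := k) (LinearMap.lTensor _ φ.toLinearMap u) (LinearMap.lTensor _ φ.toLinearMap w) =
      LinearMap.lTensor _ φ.toLinearMap (ev (k := k) u w) := by
  induction w with
  | zero => simp
  | add u v hu hv => simp only [map_add, hu, hv]
  | tmul n x =>
    induction u with
    | zero => simp
    | add u v hu hv => simp only [map_add, LinearMap.add_apply, hu, hv]
    | tmul a c => simp

lemma ev_tw (φ : H →ₐ[k] B) (v : (X.M →ₗ[H] N.M) ⊗[k] B) (w : X.M ⊗[k] B) :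
    ev (k := k) (tw (homρ hS1 hS2 X N hX) φ.toLinearMap v) (tw X.ρ φ.toLinearMap w) =
      tw N.ρ φ.toLinearMap (ev (k := k) v w) := by
  induction v with
  | zero => simp
  | add u v hu hv => simp only [map_add, LinearMap.add_apply, hu, hv]
  | tmul f b =>
    induction w with
    | zero => simp
    | add u v hu hv => simp only [map_add, hu, hv]
    | tmul x c =>
      rw [tw_tmul, tw_tmul, ev_rmul_left, ev_rmul, ev_lTensor]
      have := homρ_spec hS1 hS2 X N hX f (x ⊗ₜ 1)
      rw [tw_id_tmul_one, LinearMap.rTensor_tmul, tw_id_tmul_one] at this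
      rw [this, ev_tmul, tw_tmul, rmul_rmul]
      rfl

lemma homρ_comod : IsComod k H (homρ hS1 hS2 X N hX) := by
  apply isComod_of_tw
  · intro f
    apply ev_ext
    intro w
    have h := ev_tw hS1 hS2 X N hX (Bialgebra.counitAlgHom k H) (f ⊗ₜ 1) w
    have h1 : ∀ {P : Type} [AddCommGroup P] [Module k P] {ρ : P →ₗ[k] P ⊗[k] H}
        (_ : IsComod k H ρ) (w : P ⊗[k] k),
        tw ρ (Bialgebra.counitAlgHom k H).toLinearMap w = w := by
      intro P _ _ ρ hρ w
      exact tw_one hρ.1 w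
    rw [h1 X.comod, h1 N.comod] at h
    exact h
  · intro f
    apply ev_ext
    intro w
    obtain ⟨w, rfl⟩ := tw_surjective X.comod (Bialgebra.comulAlgHom k H) w
    have hR := ev_tw hS1 hS2 X N hX (Bialgebra.comulAlgHom k H) (f ⊗ₜ 1) w
    have hX2 : ∀ w, tw X.ρ (Bialgebra.comulAlgHom k H).toLinearMap w =
        tw X.ρ (Algebra.TensorProduct.includeLeft (R := k) (S := k) (A := H) (B := H)).toLinearMap
        (tw X.ρ (Algebra.TensorProduct.includeRight (R := k) (A := H) (B := H)).toLinearMap w) := by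
      intro w
      rw [tw_tw X.comod.2, incl_conv]; rfl
    have hN2 : ∀ w, tw N.ρ (Bialgebra.comulAlgHom k H).toLinearMap w =
        tw N.ρ (Algebra.TensorProduct.includeLeft (R := k) (S := k) (A := H) (B := H)).toLinearMap
        (tw N.ρ (Algebra.TensorProduct.includeRight (R := k) (A := H) (B := H)).toLinearMap w) := by
      intro w
      rw [tw_tw N.comod.2, incl_conv]; rfl
    refine Eq.trans ?_ hR.symm
    rw [hX2, hN2, ev_tw, ev_tw]

lemma homρ_compat : IsYDCompat k H Sinv (homρ hS1 hS2 X N hX) := by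
  rw [isYDCompat_iff]
  intro h f
  apply ev_ext
  intro w
  obtain ⟨w, rfl⟩ := tw_surjective X.comod (AlgHom.id k H) w
  have h1 := homρ_spec hS1 hS2 X N hX (h • f) w
  have h2 := homρ_spec hS1 hS2 X N hX f w
  have hact : ∀ (z : H ⊗[k] H) (v : (X.M →ₗ[H] N.M) ⊗[k] H) (w : X.M ⊗[k] H),
      ev (k := k) (act (k := k) z v) w = act (k := k) z (ev (k := k) v w) := by
    intro z v w
    induction w with
    | zero => simp
    | add u v hu hv => simp only [map_add, hu, hv]
    | tmul n x =>
      induction v with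
      | zero => simp
      | add u v hu hv => simp only [map_add, LinearMap.add_apply, hu, hv]
      | tmul a c =>
        induction z with
        | zero => simp
        | add u v hu hv => simp only [map_add, LinearMap.add_apply, hu, hv]
        | tmul d e => simp [mul_assoc]
  rw [hact]
  refine h1.trans ?_
  refine Eq.trans ?_ (congrArg _ h2.symm)
  rw [← tw_smul]
  congr 1
  rw [← LinearMap.comp_apply, ← LinearMap.rTensor_comp]
  rfl

/-- `Hom_H(X, N)` as a Yetter-Drinfeld module. -/
def homObj : YDCat k H Sinv where
  M := X.M →ₗ[H] N.M
  ρ := homρ hS1 hS2 X N hX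
  comod := homρ_comod hS1 hS2 X N hX
  compat := homρ_compat hS1 hS2 X N hX

lemma homρ_coinv (f : X.M →ₗ[H] N.M) :
    homρ hS1 hS2 X N hX f = f ⊗ₜ 1 ↔ IsHom k H X.ρ N.ρ (resK (k := k) f) := by
  constructor
  · intro h
    refine ⟨fun h x => by simp, ?_⟩
    ext x
    have := homρ_spec hS1 hS2 X N hX f (x ⊗ₜ 1)
    rw [h, ev_tmul_one_left, tw_id_tmul_one, LinearMap.rTensor_tmul, tw_id_tmul_one] at this
    exact this.symm
  · intro h
    apply ev_ext
    intro w
    obtain ⟨w, rfl⟩ := tw_surjective X.comod (AlgHom.id k H) w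
    refine (homρ_spec hS1 hS2 X N hX f w).trans ?_
    rw [ev_tmul_one_left]
    exact (rTensor_tw h.2 LinearMap.id w).symm

lemma postcomp_isHom (N' : YDCat k H Sinv) (g : N.M →ₗ[k] N'.M) (hg : IsHom k H N.ρ N'.ρ g) :
    IsHom k H (homρ hS1 hS2 X N hX) (homρ hS1 hS2 X N' hX)
      (postcompH (k := k) (H := H) (X := X.M) g hg.1) := by
  constructor
  · intro h f
    ext x
    exact hg.1 h (f x)
  · refine LinearMap.ext fun f => ?_
    rw [LinearMap.comp_apply, LinearMap.comp_apply]
    apply ev_ext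
    intro w
    obtain ⟨w, rfl⟩ := tw_surjective X.comod (AlgHom.id k H) w
    refine (homρ_spec hS1 hS2 X N' hX _ w).trans ?_
    have h1 : ∀ (v : (X.M →ₗ[H] N.M) ⊗[k] H) (w : X.M ⊗[k] H),
        ev (k := k) (LinearMap.rTensor H (postcompH (k := k) (H := H) (X := X.M) g hg.1) v) w =
          LinearMap.rTensor H g (ev (k := k) v w) := by
      intro v w
      induction w with
      | zero => simp
      | add u v hu hv => simp only [map_add, hu, hv]
      | tmul n x =>
        induction v with
        | zero => simp
        | add u v hu hv => simp only [map_add, LinearMap.add_apply, hu, hv]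
        | tmul a c => simp [postcompH]
    rw [h1]
    refine Eq.trans ?_ (congrArg _ (homρ_spec hS1 hS2 X N hX f w).symm)
    rw [rTensor_tw hg.2, ← LinearMap.comp_apply (LinearMap.rTensor H g), ← LinearMap.rTensor_comp]
    rfl

end
end HomObj

section SubQuot
variable {k H : Type} [Field k] [CommRing H] [HopfAlgebra k H] {Sinv : H →ₗ[k] H}
variable {P Q : Type}
  [AddCommGroup P] [Module k P] [Module H P] [IsScalarTower k H P] [SMulCommClass H k P]
  [AddCommGroup Q] [Module k Q] [Module H Q] [IsScalarTower k H Q] [SMulCommClass H k Q]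

lemma nat_counit (i : P →ₗ[k] Q) (w : P ⊗[k] H) :
    (TensorProduct.rid k Q) ((LinearMap.lTensor Q (Coalgebra.counit (R := k) (A := H)))
      (LinearMap.rTensor H i w)) =
    i ((TensorProduct.rid k P) ((LinearMap.lTensor P (Coalgebra.counit (R := k) (A := H))) w)) := by
  induction w with
  | zero => simp
  | add u v hu hv => simp only [map_add, hu, hv]
  | tmul n x => simp

lemma nat_comul (i : P →ₗ[k] Q) (w : P ⊗[k] H) :
    (LinearMap.lTensor Q (Coalgebra.comul (R := k) (A := H))) (LinearMap.rTensor H i w) =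
    LinearMap.rTensor (H ⊗[k] H) i
      ((LinearMap.lTensor P (Coalgebra.comul (R := k) (A := H))) w) := by
  induction w with
  | zero => simp
  | add u v hu hv => simp only [map_add, hu, hv]
  | tmul n x => simp

lemma nat_assoc (i : P →ₗ[k] Q) (w : (P ⊗[k] H) ⊗[k] H) :
    (TensorProduct.assoc k Q H H) (LinearMap.rTensor H (LinearMap.rTensor H i) w) =
    LinearMap.rTensor (H ⊗[k] H) i ((TensorProduct.assoc k P H H) w) := by
  induction w with
  | zero => simp
  | add u v hu hv => simp only [map_add, hu, hv]
  | tmul n x =>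
    induction n with
    | zero => simp
    | add u v hu hv => simp only [map_add, TensorProduct.add_tmul, hu, hv]
    | tmul n y => simp

lemma nat_coassoc {ρP : P →ₗ[k] P ⊗[k] H} {ρQ : Q →ₗ[k] Q ⊗[k] H} (i : P →ₗ[k] Q)
    (hi : ρQ.comp i = (LinearMap.rTensor H i).comp ρP) (m : P) :
    (TensorProduct.assoc k Q H H) ((LinearMap.rTensor H ρQ) (ρQ (i m))) =
    LinearMap.rTensor (H ⊗[k] H) i
      ((TensorProduct.assoc k P H H) ((LinearMap.rTensor H ρP) (ρP m))) := by
  have h1 : ρQ (i m) = LinearMap.rTensor H i (ρP m) := LinearMap.congr_fun hi m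
  rw [h1, ← nat_assoc, ← LinearMap.comp_apply (LinearMap.rTensor H ρQ), ← LinearMap.rTensor_comp,
    hi, LinearMap.rTensor_comp, LinearMap.comp_apply]

lemma comod_of_inj {ρP : P →ₗ[k] P ⊗[k] H} {ρQ : Q →ₗ[k] Q ⊗[k] H} (i : P →ₗ[k] Q)
    (hi : ρQ.comp i = (LinearMap.rTensor H i).comp ρP) (hinj : Function.Injective i)
    (hQ : IsComod k H ρQ) : IsComod k H ρP := by
  have h1 : ∀ m, ρQ (i m) = LinearMap.rTensor H i (ρP m) := LinearMap.congr_fun hi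
  constructor
  · intro m
    apply hinj
    rw [← nat_counit, ← h1, hQ.1]
  · intro m
    apply Module.Flat.rTensor_preserves_injective_linearMap (M := H ⊗[k] H) i hinj
    rw [← nat_coassoc i hi, hQ.2, h1, nat_comul]

lemma comod_of_surj {ρP : P →ₗ[k] P ⊗[k] H} {ρQ : Q →ₗ[k] Q ⊗[k] H} (i : P →ₗ[k] Q)
    (hi : ρQ.comp i = (LinearMap.rTensor H i).comp ρP) (hs : Function.Surjective i)
    (hP : IsComod k H ρP) : IsComod k H ρQ := by
  have h1 : ∀ m, ρQ (i m) = LinearMap.rTensor H i (ρP m) := LinearMap.congr_fun hi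
  constructor
  · intro m
    obtain ⟨m, rfl⟩ := hs m
    rw [h1, nat_counit, hP.1]
  · intro m
    obtain ⟨m, rfl⟩ := hs m
    rw [nat_coassoc i hi, hP.2, h1, nat_comul]

lemma compat_of_inj {ρP : P →ₗ[k] P ⊗[k] H} {ρQ : Q →ₗ[k] Q ⊗[k] H} (i : P →ₗ[k] Q)
    (hi : IsHom k H ρP ρQ i) (hinj : Function.Injective i)
    (hQ : IsYDCompat k H Sinv ρQ) : IsYDCompat k H Sinv ρP := by
  have h1 : ∀ m, ρQ (i m) = LinearMap.rTensor H i (ρP m) := LinearMap.congr_fun hi.2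
  rw [isYDCompat_iff] at hQ ⊢
  intro h m
  apply Module.Flat.rTensor_preserves_injective_linearMap (M := H) i hinj
  rw [← h1, hi.1, hQ, h1, rTensor_act hi.1]

lemma compat_of_surj {ρP : P →ₗ[k] P ⊗[k] H} {ρQ : Q →ₗ[k] Q ⊗[k] H} (i : P →ₗ[k] Q)
    (hi : IsHom k H ρP ρQ i) (hs : Function.Surjective i)
    (hP : IsYDCompat k H Sinv ρP) : IsYDCompat k H Sinv ρQ := by
  have h1 : ∀ m, ρQ (i m) = LinearMap.rTensor H i (ρP m) := LinearMap.congr_fun hi.2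
  rw [isYDCompat_iff] at hP ⊢
  intro h m
  obtain ⟨m, rfl⟩ := hs m
  rw [← hi.1, h1, h1, hP, rTensor_act hi.1]

lemma exists_sub (A : YDCat k H Sinv) (p : Submodule H A.M) (hp : IsSubobject A.ρ p) :
    ∃ (B : YDCat k H Sinv) (f : B.M →ₗ[k] A.M), IsHom k H B.ρ A.ρ f ∧
      Function.Injective f ∧ LinearMap.range f = p.restrictScalars k := by
  let i : ↥p →ₗ[k] A.M := p.subtype.restrictScalars k
  have hinj : Function.Injective i := p.subtype_injective
  have hinj' : Function.Injective (LinearMap.rTensor H i) :=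
    Module.Flat.rTensor_preserves_injective_linearMap (M := H) i hinj
  let r : ↥p →ₗ[k] ↥p ⊗[k] H :=
    (LinearEquiv.ofInjective (LinearMap.rTensor H i) hinj').symm.toLinearMap ∘ₗ
      LinearMap.codRestrict _ (A.ρ ∘ₗ i) (fun c => hp c.1 c.2)
  have hr : ∀ m, LinearMap.rTensor H i (r m) = A.ρ (i m) := by
    intro m
    have := LinearEquiv.apply_symm_apply (LinearEquiv.ofInjective (LinearMap.rTensor H i) hinj')
      (LinearMap.codRestrict _ (A.ρ ∘ₗ i) (fun c => hp c.1 c.2) m)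
    exact congrArg Subtype.val this
  have hc : A.ρ.comp i = (LinearMap.rTensor H i).comp r := by
    ext m; exact (hr m).symm
  have hH : IsHom k H r A.ρ i := ⟨fun h a => rfl, hc⟩
  refine ⟨{ M := ↥p, ρ := r, comod := comod_of_inj i hc hinj A.comod,
            compat := compat_of_inj i hH hinj A.compat }, i, hH, hinj, ?_⟩
  ext x
  simp [i]

lemma exists_quot (A : YDCat k H Sinv) (p : Submodule H A.M) (hp : IsSubobject A.ρ p) :
    ∃ (B : YDCat k H Sinv) (g : A.M →ₗ[k] B.M), IsHom k H A.ρ B.ρ g ∧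
      Function.Surjective g ∧ LinearMap.ker g = p.restrictScalars k := by
  let i : ↥p →ₗ[k] A.M := p.subtype.restrictScalars k
  let g : A.M →ₗ[k] A.M ⧸ p := p.mkQ.restrictScalars k
  have hs : Function.Surjective g := p.mkQ_surjective
  have hgi : g ∘ₗ i = 0 := by
    ext x; simp [g, i]
  have hker : p.restrictScalars k ≤ LinearMap.ker ((LinearMap.rTensor H g) ∘ₗ A.ρ) := by
    intro m hm
    obtain ⟨w, hw⟩ := hp m hm
    rw [LinearMap.mem_ker, LinearMap.comp_apply, ← hw]
    have hgi' : g ∘ₗ (p.restrictScalars k).subtype = 0 := hgi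
    rw [← LinearMap.comp_apply, ← LinearMap.rTensor_comp, hgi']
    simp
  let r : A.M ⧸ p →ₗ[k] (A.M ⧸ p) ⊗[k] H :=
    (Submodule.liftQ (p.restrictScalars k) ((LinearMap.rTensor H g) ∘ₗ A.ρ) hker) ∘ₗ
      (Submodule.Quotient.restrictScalarsEquiv k p).symm.toLinearMap
  have hc : r.comp g = (LinearMap.rTensor H g).comp A.ρ := by
    ext m; rfl
  have hH : IsHom k H A.ρ r g := ⟨fun h a => rfl, hc⟩
  refine ⟨{ M := A.M ⧸ p, ρ := r, comod := comod_of_surj g hc hs A.comod,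
            compat := compat_of_surj g hH hs A.compat }, g, hH, hs, ?_⟩
  ext x
  simp [g]

lemma range_isSubobject (A B : YDCat k H Sinv) (s : B.M →ₗ[H] A.M)
    (hs : IsHom k H B.ρ A.ρ (resK (k := k) s)) : IsSubobject A.ρ (LinearMap.range s) := by
  rintro m ⟨x, rfl⟩
  have h1 : A.ρ (s x) = LinearMap.rTensor H (resK (k := k) s) (B.ρ x) := LinearMap.congr_fun hs.2 x
  let t : B.M →ₗ[k] ↥((LinearMap.range s).restrictScalars k) :=
    LinearMap.codRestrict _ (resK (k := k) s) (fun c => ⟨c, rfl⟩)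
  have h2 : resK (k := k) s = ((LinearMap.range s).restrictScalars k).subtype ∘ₗ t := rfl
  rw [h1, h2, LinearMap.rTensor_comp]
  exact ⟨_, rfl⟩

lemma exists_compl (hS1 : ∀ h : H, Sinv (HopfAlgebra.antipode (R := k) (A := H) h) = h)
    (hS2 : ∀ h : H, HopfAlgebra.antipode (R := k) (A := H) (Sinv h) = h)
    (hdagger : DaggerYD k H Sinv) (hcoinv : CoinvExactYD k H Sinv)
    (A : YDCat k H Sinv) (hA : Module.Finite H A.M) (p : Submodule H A.M)
    (hp : IsSubobject A.ρ p) : ∃ q : Submodule H A.M, IsSubobject A.ρ q ∧ IsCompl p q := by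
  obtain ⟨P, f, hf, hfi, hfr⟩ := exists_sub A p hp
  obtain ⟨X, g, hg, hgs, hgk⟩ := exists_quot A p hp
  let g' : A.M →ₗ[H] X.M := { toFun := g, map_add' := map_add g, map_smul' := hg.1 }
  have hX : Module.Finite H X.M := Module.Finite.of_surjective g' hgs
  obtain ⟨d1, d2, d3⟩ := hdagger X hX P A X f g hf hg hfi hgs (hfr.trans hgk.symm)
  obtain ⟨-, -, c3⟩ := hcoinv (homObj hS1 hS2 X P hX) (homObj hS1 hS2 X A hX)
    (homObj hS1 hS2 X X hX) (postcompH (X := X.M) f hf.1) (postcompH (X := X.M) g hg.1)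
    (postcomp_isHom hS1 hS2 X P hX A f hf) (postcomp_isHom hS1 hS2 X A hX X g hg) d1 d3 d2
  have hid : (LinearMap.id : X.M →ₗ[H] X.M) ∈ coinv (homρ hS1 hS2 X X hX) := by
    rw [mem_coinv, homρ_coinv]
    refine ⟨fun _ _ => rfl, ?_⟩
    have : resK (k := k) (LinearMap.id : X.M →ₗ[H] X.M) = LinearMap.id := rfl
    rw [this, LinearMap.rTensor_id]
    rfl
  obtain ⟨⟨s₀, hs⟩, hse⟩ := c3 ⟨LinearMap.id, hid⟩
  let s : X.M →ₗ[H] A.M := s₀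
  have hs' : IsHom k H X.ρ A.ρ (resK (k := k) s) :=
    (homρ_coinv hS1 hS2 X A hX s).1 (mem_coinv.1 hs)
  have hsec : ∀ x, g (s x) = x := fun x =>
    LinearMap.congr_fun (congrArg Subtype.val hse : _ = (LinearMap.id : X.M →ₗ[H] X.M)) x
  refine ⟨LinearMap.range (s : X.M →ₗ[H] A.M), range_isSubobject A X s hs', ?_⟩
  have hmem : ∀ m, m ∈ p ↔ g m = 0 := by
    intro m
    rw [← LinearMap.mem_ker, hgk]; rfl
  constructor
  · rw [Submodule.disjoint_def]
    rintro _ hx ⟨x, rfl⟩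
    rw [hmem] at hx
    rw [hsec] at hx
    rw [hx]; exact map_zero s
  · rw [codisjoint_iff, eq_top_iff]
    intro m _
    rw [Submodule.mem_sup]
    refine ⟨m - s (g m), ?_, s (g m), ⟨_, rfl⟩, sub_add_cancel _ _⟩
    rw [hmem, map_sub, hsec, sub_self]

end SubQuot

section Lattice
variable {k H : Type} [Field k] [CommRing H] [HopfAlgebra k H] {Sinv : H →ₗ[k] H}
variable {M : Type} [AddCommGroup M] [Module k M] [Module H M] [IsScalarTower k H M]
  [SMulCommClass H k M]

lemma mem_range_iff (p : Submodule H M) (w : M ⊗[k] H) :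
    w ∈ LinearMap.range (LinearMap.rTensor H (p.restrictScalars k).subtype) ↔
      ∀ φ : H →ₗ[k] k, contract φ w ∈ p := by
  classical
  constructor
  · rintro ⟨v, rfl⟩ φ
    induction v with
    | zero => simp
    | add u v hu hv => rw [map_add, map_add]; exact p.add_mem hu hv
    | tmul n x =>
      simp only [contract, LinearMap.rTensor_tmul, LinearMap.comp_apply, LinearMap.lTensor_tmul,
        LinearEquiv.coe_coe, TensorProduct.rid_tmul]
      exact (p.restrictScalars k).smul_mem _ n.2
  · intro h
    let b := Module.Basis.ofVectorSpace k H
    let e := TensorProduct.equivFinsuppOfBasisRight (M := M) b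
    have h1 : w = e.symm (e w) := (e.symm_apply_apply _).symm
    rw [h1, TensorProduct.equivFinsuppOfBasisRight_symm_apply]
    apply Submodule.sum_mem
    intro i _
    have hi : e w i ∈ p := by
      have := h (b.coord i)
      rw [TensorProduct.equivFinsuppOfBasisRight_apply]
      exact this
    exact ⟨(⟨e w i, hi⟩ : ↥(p.restrictScalars k)) ⊗ₜ b i, rfl⟩

lemma isSubobject_iff (ρ : M →ₗ[k] M ⊗[k] H) (p : Submodule H M) :
    IsSubobject ρ p ↔ ∀ φ : H →ₗ[k] k,
      p.restrictScalars k ≤ (p.restrictScalars k).comap (contract φ ∘ₗ ρ) := by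
  constructor
  · intro h φ m hm
    exact (mem_range_iff p _).1 (h m hm) φ
  · intro h m hm
    exact (mem_range_iff p _).2 fun φ => h φ hm

lemma isSubobject_sInf (ρ : M →ₗ[k] M ⊗[k] H) (s : Set (Submodule H M))
    (hs : ∀ p ∈ s, IsSubobject ρ p) : IsSubobject ρ (sInf s) := by
  rw [isSubobject_iff]
  intro φ m hm
  change contract φ (ρ m) ∈ sInf s
  rw [Submodule.mem_sInf]
  intro p hp
  exact (isSubobject_iff ρ p).1 (hs p hp) φ ((Submodule.mem_sInf.1 hm) p hp)

lemma isSubobject_sSup (ρ : M →ₗ[k] M ⊗[k] H) (s : Set (Submodule H M))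
    (hs : ∀ p ∈ s, IsSubobject ρ p) : IsSubobject ρ (sSup s) := by
  rw [isSubobject_iff]
  intro φ m hm
  change m ∈ sSup s at hm
  change contract φ (ρ m) ∈ sSup s
  rw [sSup_eq_iSup'] at hm
  induction hm using Submodule.iSup_induction' with
  | mem i x hx =>
    exact (le_sSup i.2) ((isSubobject_iff ρ i.1).1 (hs i.1 i.2) φ hx)
  | zero => rw [map_zero, map_zero]; exact Submodule.zero_mem _
  | add x y _ _ h1 h2 => rw [map_add, map_add]; exact Submodule.add_mem _ h1 h2

/-- The complete lattice of subobjects. -/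
def subLat (ρ : M →ₗ[k] M ⊗[k] H) : CompleteSublattice (Submodule H M) :=
  CompleteSublattice.mk' {p | IsSubobject ρ p} (fun s hs => isSubobject_sSup ρ s hs)
    (fun s hs => isSubobject_sInf ρ s hs)

lemma mem_subLat (ρ : M →ₗ[k] M ⊗[k] H) (p : Submodule H M) :
    p ∈ subLat ρ ↔ IsSubobject ρ p := Iff.rfl

lemma semisimple_of_compl [IsNoetherian H M] (ρ : M →ₗ[k] M ⊗[k] H)
    (hc : ∀ p : Submodule H M, IsSubobject ρ p →
      ∃ q : Submodule H M, IsSubobject ρ q ∧ IsCompl p q) : IsSemisimpleObj ρ := by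
  let L := subLat ρ
  have hmod : IsModularLattice L := ⟨fun {x} y {z} h => by
    change ((x ⊔ y) ⊓ z : Submodule H M) ≤ (x ⊔ y ⊓ z : Submodule H M)
    exact IsModularLattice.sup_inf_le_assoc_of_le (y : Submodule H M) h⟩
  have hcomp : ComplementedLattice L := by
    rw [CompleteSublattice.isComplemented_iff]
    intro p hp
    obtain ⟨q, h1, h2⟩ := hc p hp
    exact ⟨q, h1, h2⟩
  have hwf : WellFoundedGT L :=
    ⟨InvImage.wf (fun x : L => (x : Submodule H M))
      (wellFounded_gt (α := Submodule H M))⟩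
  have hcg : IsCompactlyGenerated L := CompleteLattice.isCompactlyGenerated_of_wellFoundedGT
  have hat : IsAtomistic L := inferInstance
  obtain ⟨s, hs1, hs2, hs3⟩ := exists_sSupIndep_of_sSup_atoms_eq_top (α := L) sSup_atoms_eq_top
  refine ⟨↥s, fun i => ((i : L) : Submodule H M), fun i => ⟨⟨(i : L).2, ?_, ?_⟩, ?_⟩, ?_, ?_⟩
  · intro h
    exact (hs3 i.2).1 (Subtype.ext h)
  · intro q hq hle
    by_cases h : q = (i : L)
    · exact Or.inr h
    · left
      have := (hs3 i.2).2 ⟨q, hq⟩ (lt_of_le_of_ne hle (fun h' => h (congrArg Subtype.val h')))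
      exact congrArg Subtype.val this
  · exact IsNoetherian.noetherian _
  · intro i
    have := (sSupIndep_iff s).1 hs1 i
    rw [CompleteSublattice.disjoint_iff] at this
    simpa only [CompleteSublattice.coe_iSup] using this
  · rw [sSup_eq_iSup'] at hs2
    have := congrArg Subtype.val hs2
    rw [CompleteSublattice.coe_iSup] at this
    exact this

end Lattice

/-- Corollary 3.2. Let `k` be a field and `H` a commutative
noetherian Hopf algebra over `k` with bijective antipode. If the category of
Yetter-Drinfeld modules satisfies condition (†) and the coinvariants functor is
exact on Yetter-Drinfeld modules, then every Yetter-Drinfeld module which is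
finitely generated as an `H`-module is a direct sum of a family of simple
subobjects that are finitely generated as `H`-modules. -/
theorem fg_YetterDrinfeld_semisimple_of_dagger_and_coinvariants_exact
    (k H : Type) [Field k] [CommRing H] [HopfAlgebra k H]
    (Sinv : H →ₗ[k] H)
    (hS1 : ∀ h : H, Sinv (HopfAlgebra.antipode (R := k) (A := H) h) = h)
    (hS2 : ∀ h : H, HopfAlgebra.antipode (R := k) (A := H) (Sinv h) = h)
    (hnoeth : IsNoetherianRing H)
    (hdagger : DaggerYD k H Sinv)
    (hcoinv : CoinvExactYD k H Sinv) :
    ∀ A : YDCat k H Sinv, Module.Finite H A.M → IsSemisimpleObj A.ρ := by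
  intro A hA
  have : IsNoetherian H A.M := isNoetherian_of_isNoetherianRing_of_finite H A.M
  exact semisimple_of_compl A.ρ (fun p hp => exists_compl hS1 hS2 hdagger hcoinv A hA p hp)
end YDPaper
end
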